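/- arXiv:1111.1755 — 10 statements merged into one kernel-verified Lean document; each statement's English description precedes it below -/
import Mathlib

section
/- Let σx ≥ 0, σy > 0 and δ ∈ (0, 2/5), and set γ = (5δ+5)/(5δ+3). Then there exist a C² function V : ℝ² → ℝ and positive constants c, C, m, b such that: (i) V(x,y) > 0 for all (x,y) ∈ ℝ²; (ii) c·‖(x,y)‖^δ ≤ V(x,y) ≤ C·(1 + ‖(x,y)‖)^((5δ+3)/2) for all (x,y) ∈ ℝ²; and (iii) (x²−y²)·∂ₓV(x,y) + 2xy·∂_yV(x,y) + σx·∂²ₓₓV(x,y) + σy·∂²_yyV(x,y) ≤ −m·V(x,y)^γ + b for all (x,y) ∈ ℝ². -/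
open Filter Topology

/-- `f` is twice differentiable at `x` with first and second derivatives `f1`, `f2`. -/
def D2 (f : ℝ → ℝ) (x f1 f2 : ℝ) : Prop :=
  ∃ g : ℝ → ℝ, (∀ᶠ z in 𝓝 x, HasDerivAt f (g z) z) ∧ g x = f1 ∧ HasDerivAt g f2 x

lemma D2.deriv1 {f : ℝ → ℝ} {x f1 f2 : ℝ} (h : D2 f x f1 f2) : deriv f x = f1 := by
  obtain ⟨g, hg, h1, h2⟩ := h
  rw [hg.self_of_nhds.deriv, h1]

lemma D2.deriv2 {f : ℝ → ℝ} {x f1 f2 : ℝ} (h : D2 f x f1 f2) : deriv (deriv f) x = f2 := by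
  obtain ⟨g, hg, h1, h2⟩ := h
  have : deriv f =ᶠ[𝓝 x] g := hg.mono fun z hz => hz.deriv
  rw [this.deriv_eq, h2.deriv]

lemma D2.congr {f f' : ℝ → ℝ} {x f1 f2 : ℝ} (h : D2 f x f1 f2) (he : f' =ᶠ[𝓝 x] f) :
    D2 f' x f1 f2 := by
  obtain ⟨g, hg, h1, h2⟩ := h
  refine ⟨g, ?_, h1, h2⟩
  filter_upwards [hg, he.eventuallyEq_nhds] with z hz hz'
  exact hz.congr_of_eventuallyEq hz'

lemma D2.cast {f : ℝ → ℝ} {x f1 f2 f1' f2' : ℝ} (h : D2 f x f1 f2) (h1 : f1' = f1)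
    (h2 : f2' = f2) : D2 f x f1' f2' := by subst h1 h2; exact h

lemma D2.add {f f' : ℝ → ℝ} {x f1 f2 f1' f2' : ℝ} (h : D2 f x f1 f2) (h' : D2 f' x f1' f2') :
    D2 (fun z => f z + f' z) x (f1 + f1') (f2 + f2') := by
  obtain ⟨g, hg, h1, h2⟩ := h
  obtain ⟨g', hg', h1', h2'⟩ := h'
  refine ⟨fun z => g z + g' z, ?_, by simp [h1, h1'], h2.add h2'⟩
  filter_upwards [hg, hg'] with z hz hz'
  exact hz.add hz'

lemma D2.const_mul {f : ℝ → ℝ} {x f1 f2 : ℝ} (c : ℝ) (h : D2 f x f1 f2) :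
    D2 (fun z => c * f z) x (c * f1) (c * f2) := by
  obtain ⟨g, hg, h1, h2⟩ := h
  refine ⟨fun z => c * g z, ?_, by simp [h1], h2.const_mul c⟩
  filter_upwards [hg] with z hz
  exact hz.const_mul c

lemma D2.comp {φ f : ℝ → ℝ} {x f1 f2 p1 p2 : ℝ} (hφ : D2 φ (f x) p1 p2) (h : D2 f x f1 f2) :
    D2 (fun z => φ (f z)) x (p1 * f1) (p2 * f1 ^ 2 + p1 * f2) := by
  obtain ⟨g, hg, h1, h2⟩ := h
  obtain ⟨G, hG, H1, H2⟩ := hφ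
  have hc : ContinuousAt f x := hg.self_of_nhds.continuousAt
  refine ⟨fun z => G (f z) * g z, ?_, by simp [h1, H1], ?_⟩
  · filter_upwards [hg, hc.eventually hG] with z hz hz'
    exact hz'.comp z hz
  · have hfx : HasDerivAt f (g x) x := hg.self_of_nhds
    have := (H2.comp x hfx).mul h2
    refine this.congr_deriv ?_
    simp only [Function.comp, ← h1, ← H1]; ring

lemma D2.const (c x : ℝ) : D2 (fun _ => c) x 0 0 :=
  ⟨fun _ => 0, Eventually.of_forall fun z => hasDerivAt_const z c, rfl, hasDerivAt_const x 0⟩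

lemma D2.id (x : ℝ) : D2 (fun z => z) x 1 0 :=
  ⟨fun _ => 1, Eventually.of_forall fun z => hasDerivAt_id z, rfl, hasDerivAt_const x 1⟩

lemma D2.sq (x : ℝ) : D2 (fun z => z ^ 2) x (2 * x) 2 := by
  refine ⟨fun z => 2 * z, Eventually.of_forall fun z => ?_, rfl, ?_⟩
  · simpa using hasDerivAt_pow 2 z
  · simpa using (hasDerivAt_id x).const_mul 2

lemma D2.exp (x : ℝ) : D2 Real.exp x (Real.exp x) (Real.exp x) :=
  ⟨Real.exp, Eventually.of_forall fun z => Real.hasDerivAt_exp z, rfl, Real.hasDerivAt_exp x⟩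

lemma D2.inv {x : ℝ} (hx : 0 < x) : D2 (fun z => z⁻¹) x (-(x ^ 2)⁻¹) (2 / x ^ 3) := by
  refine ⟨fun z => -(z ^ 2)⁻¹, ?_, rfl, ?_⟩
  · filter_upwards [eventually_gt_nhds hx] with z hz
    exact hasDerivAt_inv hz.ne'
  · have h0 : HasDerivAt (fun z : ℝ => z ^ 2) (2 * x) x := by simpa using hasDerivAt_pow 2 x
    have := (h0.fun_inv (by positivity)).neg
    refine this.congr_deriv ?_
    field_simp

lemma D2.log {x : ℝ} (hx : 0 < x) : D2 Real.log x x⁻¹ (-(x ^ 2)⁻¹) := by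
  refine ⟨fun z => z⁻¹, ?_, rfl, hasDerivAt_inv hx.ne'⟩
  filter_upwards [eventually_gt_nhds hx] with z hz
  exact Real.hasDerivAt_log hz.ne'

lemma D2.sqrt {x : ℝ} (hx : 0 < x) :
    D2 Real.sqrt x (1 / (2 * √x)) (-(1 / (4 * √x ^ 3))) := by
  refine ⟨fun z => 1 / (2 * √z), ?_, rfl, ?_⟩
  · filter_upwards [eventually_gt_nhds hx] with z hz
    exact Real.hasDerivAt_sqrt hz.ne'
  · have hs : 0 < √x := Real.sqrt_pos.2 hx
    have := ((Real.hasDerivAt_sqrt hx.ne').const_mul 2).fun_inv (by positivity)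
    simp only [one_div] at *
    refine this.congr_deriv ?_
    field_simp
    norm_num

lemma D2.arsinh (x : ℝ) :
    D2 Real.arsinh x (√(1 + x ^ 2))⁻¹ (-(x / √(1 + x ^ 2) ^ 3)) := by
  refine ⟨fun z => (√(1 + z ^ 2))⁻¹, Eventually.of_forall fun z => Real.hasDerivAt_arsinh z,
    rfl, ?_⟩
  have hp : 0 < 1 + x ^ 2 := by positivity
  have hs : 0 < √(1 + x ^ 2) := Real.sqrt_pos.2 hp
  have h0 : HasDerivAt (fun z : ℝ => 1 + z ^ 2) (2 * x) x := by
    simpa using (hasDerivAt_pow 2 x).const_add 1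
  have := (h0.sqrt hp.ne').fun_inv hs.ne'
  refine this.congr_deriv ?_
  field_simp

noncomputable def rr (x y : ℝ) : ℝ := √(x ^ 2 + y ^ 2)
noncomputable def DD (x y : ℝ) : ℝ := rr x y - x + (x ^ 2 + y ^ 2)⁻¹
noncomputable def LL (x y : ℝ) : ℝ := Real.log (x ^ 2 + y ^ 2) - Real.log (DD x y)
noncomputable def V1 (d x y : ℝ) : ℝ :=
  Real.smoothTransition (x ^ 2 + y ^ 2 - 1) * Real.exp (d * LL x y)
noncomputable def FF (q k x y : ℝ) : ℝ :=
  Real.exp (q * Real.arsinh x + -k * y ^ 2 * Real.exp (Real.arsinh x))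

/-- The generator. -/
noncomputable def gen (σx σy : ℝ) (V : ℝ → ℝ → ℝ) (x y : ℝ) : ℝ :=
  (x^2 - y^2) * deriv (fun x' => V x' y) x
            + 2*x*y * deriv (fun y' => V x y') y
            + σx * deriv (deriv (fun x' => V x' y)) x
            + σy * deriv (deriv (fun y' => V x y')) y

lemma FF_dx (q k x y : ℝ) : ∀ s t : ℝ, s = √(1 + x ^ 2) → t = k * y ^ 2 * Real.exp (Real.arsinh x) →
    D2 (fun x' => FF q k x' y) x (FF q k x y * ((q - t) / s))
      (FF q k x y * (((q - t) / s) ^ 2 + (-t / s ^ 2 - (q - t) * x / s ^ 3))) := by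
  rintro s t rfl rfl
  have hs : 0 < √(1 + x ^ 2) := Real.sqrt_pos.2 (by positivity)
  have h1 := D2.arsinh x
  have h2 := (h1.const_mul q).add (((D2.exp _).comp h1).const_mul (-k * y ^ 2))
  refine ((D2.exp _).comp h2).cast ?_ ?_
  · unfold FF; field_simp; ring
  · unfold FF; field_simp; ring

lemma FF_dy (q k x y : ℝ) : ∀ ρ : ℝ, ρ = Real.exp (Real.arsinh x) →
    D2 (fun y' => FF q k x y') y (FF q k x y * (-2 * k * ρ * y))
      (FF q k x y * ((-2 * k * ρ * y) ^ 2 + (-2 * k * ρ))) := by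
  rintro ρ rfl
  have h2 := (D2.const (q * Real.arsinh x) y).add
    ((D2.sq y).const_mul (-k * Real.exp (Real.arsinh x)))
  have h3 := ((D2.exp _).comp h2)
  have e : ∀ y', Real.exp (q * Real.arsinh x + -k * Real.exp (Real.arsinh x) * y' ^ 2)
    = FF q k x y' := by
    intro y'; unfold FF; congr 1; ring
  simp only [e] at h3
  refine h3.cast ?_ ?_ <;> ring

lemma rho_facts (x : ℝ) : ∀ s ρ : ℝ, s = √(1 + x ^ 2) → ρ = Real.exp (Real.arsinh x) →
    0 < ρ ∧ 1 ≤ s ∧ s ^ 2 = 1 + x ^ 2 ∧ ρ = x + s ∧ s - x = 1 / ρ := by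
  rintro s ρ hs hρ
  have h0 : 0 < ρ := by rw [hρ]; positivity
  have h2 : s ^ 2 = 1 + x ^ 2 := by rw [hs]; exact Real.sq_sqrt (by positivity)
  have h1 : 1 ≤ s := by rw [hs]; exact Real.one_le_sqrt.2 (by nlinarith [sq_nonneg x])
  have h3 : ρ = x + s := by rw [hρ, hs, Real.exp_arsinh]
  refine ⟨h0, h1, h2, h3, ?_⟩
  rw [eq_div_iff h0.ne', h3]; linarith

lemma FF_tail (q k x y : ℝ) (hk : 0 < k) : ∀ ρ t : ℝ, ρ = Real.exp (Real.arsinh x) →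
    t = k * y ^ 2 * ρ → FF q k x y * (1 + t) ^ 2 / ρ ≤ 4 * Real.exp ((q - 1) * Real.arsinh x) := by
  rintro ρ t hρ ht
  have h0 : 0 < ρ := by rw [hρ]; positivity
  have ht0 : 0 ≤ t := by rw [ht]; positivity
  have hF : FF q k x y = Real.exp ((q - 1) * Real.arsinh x) * ρ * Real.exp (-t) := by
    unfold FF; rw [hρ, ← Real.exp_add, ← Real.exp_add, ht, hρ]; congr 1; ring
  have h1 : 1 + t ≤ 2 * Real.exp (t / 2) := by
    have := Real.add_one_le_exp (t / 2); linarith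
  have h2 : (1 + t) ^ 2 ≤ 4 * Real.exp t := by
    have e : Real.exp t = Real.exp (t / 2) ^ 2 := by rw [← Real.exp_nat_mul]; congr 1; push_cast; ring
    rw [e]; nlinarith
  have h3 : (1 + t) ^ 2 * Real.exp (-t) ≤ 4 := by
    rw [Real.exp_neg, ← div_eq_mul_inv, div_le_iff₀ (Real.exp_pos _)]; exact h2
  rw [hF, div_le_iff₀ h0]
  have := mul_le_mul_of_nonneg_left h3
    (by positivity : 0 ≤ Real.exp ((q - 1) * Real.arsinh x) * ρ)
  linarith

lemma exp_rho_le (q x y : ℝ) (hq0 : 0 ≤ q) (hq : q ≤ 2) :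
    Real.exp ((q - 1) * Real.arsinh x) ≤ 2 * (1 + rr x y) := by
  obtain ⟨h0, h1, h2, h3, h4⟩ := rho_facts x _ _ rfl rfl
  set ρ := Real.exp (Real.arsinh x) with hρ
  set s := √(1 + x ^ 2)
  have hr : s ≤ 1 + rr x y := by
    have hr0 : 0 ≤ rr x y := Real.sqrt_nonneg _
    have hr2 : rr x y ^ 2 = x ^ 2 + y ^ 2 := Real.sq_sqrt (by positivity)
    apply Real.sqrt_le_iff.2 ⟨by linarith, by nlinarith [sq_nonneg y]⟩
  have hi : 1 / ρ = Real.exp (-Real.arsinh x) := by rw [Real.exp_neg, one_div]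
  have hi0 : 0 < 1 / ρ := by positivity
  have : Real.exp ((q - 1) * Real.arsinh x) ≤ ρ + 1 / ρ := by
    rcases le_total 0 (Real.arsinh x) with h | h
    · have : Real.exp ((q - 1) * Real.arsinh x) ≤ ρ := Real.exp_le_exp.2 (by nlinarith)
      linarith
    · have : Real.exp ((q - 1) * Real.arsinh x) ≤ 1 / ρ := by
        rw [hi]; exact Real.exp_le_exp.2 (by nlinarith)
      linarith
  linarith

lemma FF_pos (q k x y : ℝ) : 0 < FF q k x y := Real.exp_pos _

lemma FF_rr (q k x y : ℝ) (hk : 0 < k) (hq0 : 0 ≤ q) (hq : q ≤ 2) :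
    rr x y * FF q k x y ≤ 2 * (Real.exp (Real.arsinh x) * FF q k x y)
      + 8 * (2 + 1 / k) * (1 + rr x y) := by
  have hT := FF_tail q k x y hk _ _ rfl rfl
  have hE := exp_rho_le q x y hq0 hq
  obtain ⟨h0, h1, h2, h3, h4⟩ := rho_facts x _ _ rfl rfl
  set ρ := Real.exp (Real.arsinh x) with hρ
  set s := √(1 + x ^ 2)
  set t := k * y ^ 2 * ρ with ht
  have hF := FF_pos q k x y
  have ht0 : 0 ≤ t := by positivity
  have hy : y ^ 2 = t / (k * ρ) := by rw [ht]; field_simp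
  have hr : rr x y ≤ s + 1 + y ^ 2 := by
    apply Real.sqrt_le_iff.2 ⟨by positivity, by nlinarith [sq_nonneg y, sq_nonneg (y^2)]⟩
  have h5 : 1 ≤ ρ + 1 / ρ := by
    linarith [le_abs_self x]
  have hi0 : 0 < 1 / ρ := by positivity
  have hs : s = (ρ + 1 / ρ) / 2 := by linarith
  have hk0 : 0 < 1 / k := by positivity
  have hr2 : rr x y ≤ 2 * ρ + (2 + 1 / k) * (1 + t) ^ 2 / ρ := by
    have e : y ^ 2 = (1 / k) * t * (1 / ρ) := by rw [hy]; field_simp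
    have : (2 + 1 / k * t) ≤ (2 + 1 / k) * (1 + t) ^ 2 := by nlinarith [mul_nonneg hk0.le ht0, mul_nonneg hk0.le (sq_nonneg t)]
    have := mul_le_mul_of_nonneg_right this hi0.le
    rw [div_eq_mul_one_div]
    nlinarith
  have := mul_le_mul_of_nonneg_right hr2 hF.le
  have hc : 0 ≤ 2 + 1 / k := by positivity
  have h6 := mul_le_mul_of_nonneg_left hT hc
  have h7 := mul_le_mul_of_nonneg_left hE hc
  have e : (2 * ρ + (2 + 1 / k) * (1 + t) ^ 2 / ρ) * FF q k x y =
    2 * (ρ * FF q k x y) + (2 + 1 / k) * (FF q k x y * (1 + t) ^ 2 / ρ) := by ring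
  linarith

set_option maxHeartbeats 2000000 in
lemma gen_FF (σx σy q k x y : ℝ) (hσx : 0 ≤ σx) (hk : 0 < k) (hkσ : k * σy = 1 / 2)
    (hq0 : 0 ≤ q) (hq : q ≤ 2) :
    gen σx σy (FF q k) x y ≤ -(1 - q / 2) * (Real.exp (Real.arsinh x) * FF q k x y)
      + 8 * (4 + 1 / k + 12 * σx) * (1 + rr x y) := by
  have hT := FF_tail q k x y hk _ _ rfl rfl
  have hE := exp_rho_le q x y hq0 hq
  obtain ⟨h0, h1, h2, h3, h4⟩ := rho_facts x _ _ rfl rfl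
  have hdx := FF_dx q k x y _ _ rfl rfl
  have hdy := FF_dy q k x y _ rfl
  unfold gen
  rw [hdx.deriv1, hdx.deriv2, hdy.deriv1, hdy.deriv2]
  set ρ := Real.exp (Real.arsinh x) with hρ
  set s := √(1 + x ^ 2)
  set t := k * y ^ 2 * ρ with ht
  have hF := FF_pos q k x y
  have ht0 : 0 ≤ t := by positivity
  have hs0 : 0 < s := by linarith
  have hi0 : 0 < 1 / ρ := by positivity
  have hs : s = (ρ + 1 / ρ) / 2 := by linarith
  have hk0 : 0 < 1 / k := by positivity
  have hsi : 1 / s ≤ 2 * (1 / ρ) := by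
    rw [mul_one_div, div_le_div_iff₀ hs0 h0]; nlinarith
  have hsi0 : 0 < 1 / s := by positivity
  have hsi1 : 1 / s ≤ 1 := by rw [div_le_one hs0]; exact h1
  have hx : |x| ≤ s := Real.abs_le_sqrt (by linarith)
  -- the pieces
  have p1 : x ^ 2 * ((q - t) / s) ≤ q * ρ / 2 + q / 2 * (1 / ρ) - s * t + 2 * t * (1 / ρ) := by
    have : x ^ 2 * ((q - t) / s) = s * q - s * t - q * (1 / s) + t * (1 / s) := by
      field_simp; rw [h2]; ring
    rw [this]
    have e1 := mul_nonneg hq0 hsi0.le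
    have e2 := mul_le_mul_of_nonneg_left hsi ht0
    have e3 : s * q = q * ρ / 2 + q / 2 * (1 / ρ) := by rw [hs]; ring
    linarith
  have p2 : -y ^ 2 * ((q - t) / s) ≤ (1 / k) * t ^ 2 * (1 / ρ) := by
    have hy : y ^ 2 = (1 / k) * t * (1 / ρ) := by rw [ht]; field_simp
    have e1 : -y ^ 2 * ((q - t) / s) = -(y ^ 2 * q * (1 / s)) + y ^ 2 * t * (1 / s) := by ring
    have e2 : 0 ≤ y ^ 2 * q * (1 / s) := by positivity
    have e3 : y ^ 2 * t * (1 / s) ≤ y ^ 2 * t * 1 := by gcongr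
    have e4 : y ^ 2 * t = (1 / k) * t ^ 2 * (1 / ρ) := by rw [hy]; ring
    linarith
  have p3 : ((q - t) / s) ^ 2 + (-t / s ^ 2 - (q - t) * x / s ^ 3) ≤ 12 * (1 + t) ^ 2 * (1 / ρ) := by
    have a1 : (q - t) ^ 2 ≤ (2 + t) ^ 2 := by
      apply sq_le_sq'  <;> linarith
    have a2 : -((q - t) * (x * (1 / s))) ≤ 2 + t := by
      have b1 : |x * (1 / s)| ≤ 1 := by
        rw [abs_mul, abs_of_pos hsi0, mul_one_div, div_le_one hs0]; exact hx
      have b2 : |q - t| ≤ 2 + t := abs_le.2 ⟨by linarith, by linarith⟩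
      calc -((q - t) * (x * (1 / s))) ≤ |(q - t) * (x * (1 / s))| := neg_le_abs _
        _ = |q - t| * |x * (1 / s)| := abs_mul _ _
        _ ≤ (2 + t) * 1 := by gcongr
        _ = _ := by ring
    have e : ((q - t) / s) ^ 2 + (-t / s ^ 2 - (q - t) * x / s ^ 3) =
      ((q - t) ^ 2 - t + -((q - t) * (x * (1 / s)))) * (1 / s) ^ 2 := by field_simp; ring
    rw [e]
    have a3 : (q - t) ^ 2 - t + -((q - t) * (x * (1 / s))) ≤ 6 * (1 + t) ^ 2 := by nlinarith
    have a4 : (1 / s) ^ 2 ≤ 2 * (1 / ρ) := by nlinarith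
    calc _ ≤ 6 * (1 + t) ^ 2 * (1 / s) ^ 2 := by gcongr
      _ ≤ 6 * (1 + t) ^ 2 * (2 * (1 / ρ)) := by gcongr
      _ = _ := by ring
  have p4 : 2 * x * y * (-2 * k * ρ * y) + σy * ((-2 * k * ρ * y) ^ 2 + (-2 * k * ρ)) =
      2 * t * (1 / ρ) - ρ := by
    have e1 : σy * ((-2 * k * ρ * y) ^ 2 + (-2 * k * ρ)) = (k * σy) * (4 * ρ * t - 2 * ρ) := by
      rw [ht]; ring
    have e2 : 2 * x * y * (-2 * k * ρ * y) = -4 * x * t := by rw [ht]; ring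
    rw [e1, hkσ, e2, ← h4]
    have : ρ * t = (x + s) * t := by rw [← h3]
    linarith
  have p5 := mul_le_mul_of_nonneg_left p3 hσx
  have p6 : (q / 2 + 4 * t + (1 / k) * t ^ 2 + 12 * σx * (1 + t) ^ 2) ≤
      (4 + 1 / k + 12 * σx) * (1 + t) ^ 2 := by
    nlinarith [mul_nonneg hk0.le ht0]
  have p7 := mul_le_mul_of_nonneg_right p6 hi0.le
  have p8 : 0 ≤ s * t := by positivity
  have p9 : (x ^ 2 - y ^ 2) * ((q - t) / s) + 2 * x * y * (-2 * k * ρ * y)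
      + σx * (((q - t) / s) ^ 2 + (-t / s ^ 2 - (q - t) * x / s ^ 3))
      + σy * ((-2 * k * ρ * y) ^ 2 + (-2 * k * ρ)) ≤
      -(1 - q / 2) * ρ + (4 + 1 / k + 12 * σx) * (1 + t) ^ 2 * (1 / ρ) := by
    linarith
  have p10 := mul_le_mul_of_nonneg_left p9 hF.le
  have hc : 0 ≤ 4 + 1 / k + 12 * σx := by positivity
  have h6 := mul_le_mul_of_nonneg_left hT hc
  have h7 := mul_le_mul_of_nonneg_left hE hc
  have e : FF q k x y * (-(1 - q / 2) * ρ + (4 + 1 / k + 12 * σx) * (1 + t) ^ 2 * (1 / ρ)) =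
    -(1 - q / 2) * (ρ * FF q k x y) + (4 + 1 / k + 12 * σx) * (FF q k x y * (1 + t) ^ 2 / ρ) := by
    ring
  rw [e] at p10
  linarith

lemma DD_facts (x y : ℝ) (h : 1 ≤ rr x y) : rr x y ^ 2 = x ^ 2 + y ^ 2 ∧ |x| ≤ rr x y ∧
    0 < DD x y ∧ 1 ≤ rr x y ^ 2 * DD x y ∧ DD x y ≤ 3 * rr x y ∧ rr x y - x ≤ DD x y ∧
    DD x y = rr x y - x + 1 / rr x y ^ 2 := by
  have h2 : rr x y ^ 2 = x ^ 2 + y ^ 2 := Real.sq_sqrt (by positivity)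
  have hx : |x| ≤ rr x y := Real.abs_le_sqrt (by nlinarith [sq_nonneg y])
  have hD : DD x y = rr x y - x + 1 / rr x y ^ 2 := by unfold DD; rw [h2, one_div]
  have hr : 0 < rr x y := by linarith
  obtain ⟨hx1, hx2⟩ := abs_le.1 hx
  have hi : 0 < 1 / rr x y ^ 2 := by positivity
  have hi1 : 1 / rr x y ^ 2 ≤ 1 := by rw [div_le_one (by positivity)]; nlinarith
  refine ⟨h2, hx, by rw [hD]; linarith, ?_, by rw [hD]; linarith, by linarith, hD⟩
  have : rr x y ^ 2 * DD x y = rr x y ^ 2 * (rr x y - x) + 1 := by rw [hD]; field_simp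
  rw [this]; nlinarith [mul_nonneg (sq_nonneg (rr x y)) (by linarith : 0 ≤ rr x y - x)]

lemma rr_comm (x y : ℝ) : rr x y = rr y x := by unfold rr; rw [add_comm]

lemma sq_dx (x y : ℝ) : D2 (fun x' => x' ^ 2 + y ^ 2) x (2 * x) 2 :=
  ((D2.sq x).add (D2.const (y ^ 2) x)).cast (by ring) (by ring)

lemma rr_dx (x y : ℝ) (h : 0 < rr x y) :
    D2 (fun x' => rr x' y) x (x / rr x y) (y ^ 2 / rr x y ^ 3) := by
  have hp : 0 < x ^ 2 + y ^ 2 := Real.sqrt_pos.1 h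
  have h2 : rr x y ^ 2 = x ^ 2 + y ^ 2 := Real.sq_sqrt (by positivity)
  refine (D2.comp (f := fun x' => x' ^ 2 + y ^ 2) (D2.sqrt hp) (sq_dx x y)).cast ?_ ?_
  · change x / rr x y = 1 / (2 * rr x y) * (2 * x); field_simp
  · change y ^ 2 / rr x y ^ 3 = -(1 / (4 * rr x y ^ 3)) * (2 * x) ^ 2 + 1 / (2 * rr x y) * 2
    field_simp; rw [h2]; ring

lemma inv_dx (x y : ℝ) (h : 0 < rr x y) :
    D2 (fun x' => (x' ^ 2 + y ^ 2)⁻¹) x (-2 * x / rr x y ^ 4)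
      (8 * x ^ 2 / rr x y ^ 6 - 2 / rr x y ^ 4) := by
  have hp : 0 < x ^ 2 + y ^ 2 := Real.sqrt_pos.1 h
  have h2 : x ^ 2 + y ^ 2 = rr x y ^ 2 := (Real.sq_sqrt (by positivity)).symm
  refine (D2.comp (f := fun x' => x' ^ 2 + y ^ 2) (D2.inv hp) (sq_dx x y)).cast ?_ ?_
  · rw [h2]; field_simp
  · rw [h2]; field_simp; ring

lemma log_dx (x y : ℝ) (h : 0 < rr x y) :
    D2 (fun x' => Real.log (x' ^ 2 + y ^ 2)) x (2 * x / rr x y ^ 2)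
      (2 / rr x y ^ 2 - 4 * x ^ 2 / rr x y ^ 4) := by
  have hp : 0 < x ^ 2 + y ^ 2 := Real.sqrt_pos.1 h
  have h2 : x ^ 2 + y ^ 2 = rr x y ^ 2 := (Real.sq_sqrt (by positivity)).symm
  refine (D2.comp (f := fun x' => x' ^ 2 + y ^ 2) (D2.log hp) (sq_dx x y)).cast ?_ ?_
  · rw [h2]; field_simp
  · rw [h2]; field_simp; ring

lemma DD_dx (x y : ℝ) (h : 0 < rr x y) :
    D2 (fun x' => DD x' y) x (x / rr x y - 1 - 2 * x / rr x y ^ 4)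
      (y ^ 2 / rr x y ^ 3 + 8 * x ^ 2 / rr x y ^ 6 - 2 / rr x y ^ 4) := by
  have := ((rr_dx x y h).add ((D2.id x).const_mul (-1))).add (inv_dx x y h)
  refine (this.congr (Eventually.of_forall fun z => ?_)).cast ?_ ?_
  · simp only [DD]; ring
  · ring
  · ring

lemma DD_dy (x y : ℝ) (h : 0 < rr x y) :
    D2 (fun y' => DD x y') y (y / rr x y - 2 * y / rr x y ^ 4)
      (x ^ 2 / rr x y ^ 3 + 8 * y ^ 2 / rr x y ^ 6 - 2 / rr x y ^ 4) := by
  rw [rr_comm] at h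
  have := ((rr_dx y x h).add (D2.const (-x) y)).add (inv_dx y x h)
  rw [rr_comm x y]
  refine (this.congr (Eventually.of_forall fun z => ?_)).cast ?_ ?_
  · simp only [DD, rr_comm x z, add_comm (x^2)]; ring
  · ring
  · ring

lemma LL_dx (x y : ℝ) (h : 1 ≤ rr x y) : ∀ r D Dx Dxx, r = rr x y → D = DD x y →
    Dx = x / r - 1 - 2 * x / r ^ 4 → Dxx = y ^ 2 / r ^ 3 + 8 * x ^ 2 / r ^ 6 - 2 / r ^ 4 →
    D2 (fun x' => LL x' y) x (2 * x / r ^ 2 - Dx / D)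
      (2 / r ^ 2 - 4 * x ^ 2 / r ^ 4 - Dxx / D + (Dx / D) ^ 2) := by
  rintro r D Dx Dxx rfl rfl rfl rfl
  have hr : 0 < rr x y := by linarith
  have hD := (DD_facts x y h).2.2.1
  have := (log_dx x y hr).add ((D2.comp (f := fun x' => DD x' y) (D2.log hD) (DD_dx x y hr)).const_mul (-1))
  refine (this.congr (Eventually.of_forall fun z => ?_)).cast ?_ ?_
  · simp only [LL]; ring
  · ring
  · ring

lemma LL_dy (x y : ℝ) (h : 1 ≤ rr x y) : ∀ r D Dy Dyy, r = rr x y → D = DD x y →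
    Dy = y / r - 2 * y / r ^ 4 → Dyy = x ^ 2 / r ^ 3 + 8 * y ^ 2 / r ^ 6 - 2 / r ^ 4 →
    D2 (fun y' => LL x y') y (2 * y / r ^ 2 - Dy / D)
      (2 / r ^ 2 - 4 * y ^ 2 / r ^ 4 - Dyy / D + (Dy / D) ^ 2) := by
  rintro r D Dx Dxx rfl rfl rfl rfl
  have hr : 0 < rr x y := by linarith
  have hr' : 0 < rr y x := by rw [rr_comm]; linarith
  have hD := (DD_facts x y h).2.2.1
  have := (log_dx y x hr').add (((D2.log hD).comp (DD_dy x y hr)).const_mul (-1))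
  rw [rr_comm y x] at this
  refine (this.congr (Eventually.of_forall fun z => ?_)).cast ?_ ?_
  · simp only [LL, add_comm (x^2)]; ring
  · ring
  · ring

lemma D2.expd {f : ℝ → ℝ} {x f1 f2 : ℝ} (d : ℝ) (h : D2 f x f1 f2) :
    D2 (fun z => Real.exp (d * f z)) x (Real.exp (d * f x) * (d * f1))
      (Real.exp (d * f x) * ((d * f1) ^ 2 + d * f2)) :=
  ((D2.exp _).comp (h.const_mul d)).cast rfl (by ring)

lemma V1_eq (d x y : ℝ) (h : 2 ≤ x ^ 2 + y ^ 2) : V1 d x y = Real.exp (d * LL x y) := by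
  unfold V1; rw [Real.smoothTransition.one_of_one_le (by linarith), one_mul]

set_option maxHeartbeats 2000000 in
lemma gen_V1 (σx σy d x y : ℝ) (hσx : 0 ≤ σx) (hσy : 0 ≤ σy) (hd0 : 0 < d) (hd : d ≤ 1)
    (hr2 : 2 ≤ rr x y) :
    gen σx σy (V1 d) x y ≤ V1 d x y * (-d * rr x y
      + (5 + 6 * σy) * (rr x y * (1 / (rr x y ^ 2 * DD x y))) + (38 * σx + 12 * σy)) := by
  have h1 : 1 ≤ rr x y := by linarith
  obtain ⟨e2, hx, hD, hD1, hD3, hDr, hDe⟩ := DD_facts x y h1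
  have hlt : 2 < x ^ 2 + y ^ 2 := by nlinarith
  have hdx := (D2.expd (f := fun x' => LL x' y) d (LL_dx x y h1 _ _ _ _ rfl rfl rfl rfl)).congr (f' := fun x' => V1 d x' y) (by
    have : ∀ᶠ z in 𝓝 x, 2 < z ^ 2 + y ^ 2 := 
      (Continuous.tendsto (by fun_prop : Continuous fun z : ℝ => z ^ 2 + y ^ 2) x).eventually_const_lt hlt
    filter_upwards [this] with z hz
    exact V1_eq d z y hz.le)
  have hdy := ((LL_dy x y h1 _ _ _ _ rfl rfl rfl rfl).expd d).congr (f' := fun y' => V1 d x y') (by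
    have : ∀ᶠ z in 𝓝 y, 2 < x ^ 2 + z ^ 2 := 
      (Continuous.tendsto (by fun_prop : Continuous fun z : ℝ => x ^ 2 + z ^ 2) y).eventually_const_lt hlt
    filter_upwards [this] with z hz
    exact V1_eq d x z hz.le)
  unfold gen
  rw [hdx.deriv1, hdx.deriv2, hdy.deriv1, hdy.deriv2, V1_eq d x y hlt.le]
  have hE := Real.exp_pos (d * LL x y)
  set E := Real.exp (d * LL x y)
  set r := rr x y with hr
  set D := DD x y with hDdef
  have hr0 : 0 < r := by linarith
  obtain ⟨hx1, hx2⟩ := abs_le.1 hx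
  set u := 1 / (r ^ 2 * D) with hu
  have hu0 : 0 < u := by positivity
  have hu1 : u ≤ 1 := by rw [hu, div_le_one (by positivity)]; exact hD1
  have hir : 1 / r ≤ 1 := by rw [div_le_one hr0]; exact h1
  have hir0 : 0 < 1 / r := by positivity
  -- drift
  have pA : (x ^ 2 - y ^ 2) * (2 * x / r ^ 2 - (x / r - 1 - 2 * x / r ^ 4) / D)
      + 2 * x * y * (2 * y / r ^ 2 - (y / r - 2 * y / r ^ 4) / D) = -r + (r + 4 * x) * u := by
    have hy : y ^ 2 = r ^ 2 - x ^ 2 := by linarith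
    have hD' : r ^ 2 * D = r ^ 2 * (r - x) + 1 := by rw [hDe]; field_simp
    have s1 : (x ^ 2 - y ^ 2) * (2 * x / r ^ 2) + 2 * x * y * (2 * y / r ^ 2) = 2 * x := by
      field_simp; rw [e2]; ring
    have s2 : (x ^ 2 - y ^ 2) * (x / r - 1 - 2 * x / r ^ 4) + 2 * x * y * (y / r - 2 * y / r ^ 4)
        = (r + 2 * x) * D - (r + 4 * x) / r ^ 2 := by
      have : 2 * x * y * (y / r - 2 * y / r ^ 4) = 2 * x * y ^ 2 * (1 / r - 2 / r ^ 4) := by ring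
      rw [this, hDe, hy]; field_simp; ring
    have s3 : (r + 4 * x) * u = ((r + 4 * x) / r ^ 2) / D := by rw [hu]; field_simp
    rw [s3]
    have s4 : ((x ^ 2 - y ^ 2) * (x / r - 1 - 2 * x / r ^ 4)
      + 2 * x * y * (y / r - 2 * y / r ^ 4)) / D = (r + 2 * x) - ((r + 4 * x) / r ^ 2) / D := by
      rw [s2]; field_simp
    have : (x ^ 2 - y ^ 2) * (2 * x / r ^ 2 - (x / r - 1 - 2 * x / r ^ 4) / D)
      + 2 * x * y * (2 * y / r ^ 2 - (y / r - 2 * y / r ^ 4) / D) =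
      ((x ^ 2 - y ^ 2) * (2 * x / r ^ 2) + 2 * x * y * (2 * y / r ^ 2)) -
      ((x ^ 2 - y ^ 2) * (x / r - 1 - 2 * x / r ^ 4)
      + 2 * x * y * (y / r - 2 * y / r ^ 4)) / D := by ring
    rw [this, s1, s4]; ring
  have hi2 : 2 / r ^ 2 ≤ 2 := by rw [div_le_iff₀ (by positivity)]; nlinarith
  have h4D : 2 / r ^ 4 / D ≤ 2 := by
    have : 2 / r ^ 4 / D = 2 / r ^ 2 * u := by rw [hu]; field_simp
    rw [this]
    calc 2 / r ^ 2 * u ≤ 2 * 1 := by gcongr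
      _ = 2 := by ring
  -- x derivatives
  have hDx : |(x / r - 1 - 2 * x / r ^ 4) / D| ≤ 3 := by
    have a1 : |x / r - 1 - 2 * x / r ^ 4| ≤ (r - x) + 2 * (1 / r ^ 2) := by
      have b1 : |x / r - 1| ≤ r - x := by
        have : x / r - 1 = -((r - x) * (1 / r)) := by field_simp; ring
        rw [this, abs_neg, abs_mul, abs_of_pos hir0, abs_of_nonneg (by linarith)]
        nlinarith
      have b2 : |2 * x / r ^ 4| ≤ 2 * (1 / r ^ 2) := by
        rw [abs_div, abs_of_pos (by positivity : 0 < r ^ 4), abs_mul, abs_two,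
          div_le_iff₀ (by positivity)]
        have : 2 * (1 / r ^ 2) * r ^ 4 = 2 * r ^ 2 := by field_simp
        rw [this]; nlinarith
      calc _ ≤ |x / r - 1| + |2 * x / r ^ 4| := abs_sub _ _
        _ ≤ _ := by linarith
    rw [abs_div, abs_of_pos hD, div_le_iff₀ hD]
    have : 0 < 1 / r ^ 2 := by positivity
    linarith
  have h2x : |2 * x / r ^ 2| ≤ 2 := by
    rw [abs_div, abs_of_pos (by positivity : 0 < r ^ 2), abs_mul, abs_two,
      div_le_iff₀ (by positivity)]
    nlinarith
  have h2y : |2 * y / r ^ 2| ≤ 2 := by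
    have hy : |y| ≤ r := Real.abs_le_sqrt (by nlinarith [sq_nonneg x])
    rw [abs_div, abs_of_pos (by positivity : 0 < r ^ 2), abs_mul, abs_two,
      div_le_iff₀ (by positivity)]
    nlinarith
  set Dx := (x / r - 1 - 2 * x / r ^ 4) / D
  have hDx2 : Dx ^ 2 ≤ 9 := by
    have := sq_le_sq' (abs_le.1 hDx).1 (abs_le.1 hDx).2; linarith
  have pX1 : (2 * x / r ^ 2 - Dx) ^ 2 ≤ 25 := by
    have : |2 * x / r ^ 2 - Dx| ≤ 5 := (abs_sub _ _).trans (by linarith)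
    have := sq_le_sq' (abs_le.1 this).1 (abs_le.1 this).2; linarith
  have pX2 : 2 / r ^ 2 - 4 * x ^ 2 / r ^ 4
      - (y ^ 2 / r ^ 3 + 8 * x ^ 2 / r ^ 6 - 2 / r ^ 4) / D + Dx ^ 2 ≤ 13 := by
    have a1 : 0 ≤ 4 * x ^ 2 / r ^ 4 := by positivity
    have a2 : 0 ≤ (y ^ 2 / r ^ 3 + 8 * x ^ 2 / r ^ 6) / D := by positivity
    rw [sub_div]; linarith
  set Dy := (y / r - 2 * y / r ^ 4) / D with hDy
  have hDy2 : Dy ^ 2 ≤ 2 * (r * u) := by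
    have a1 : y ^ 2 ≤ 2 * r * D := by nlinarith
    have a2 : Dy ^ 2 = y ^ 2 * (1 - 2 / r ^ 3) ^ 2 / (r ^ 2 * D ^ 2) := by rw [hDy]; field_simp
    have a3 : (1 - 2 / r ^ 3) ^ 2 ≤ 1 := by
      have b1 : 2 / r ^ 3 ≤ 1 := by
        rw [div_le_one (by positivity)]; nlinarith [sq_nonneg r]
      have b2 : 0 < 2 / r ^ 3 := by positivity
      nlinarith
    rw [a2, div_le_iff₀ (by positivity)]
    have a4 : 2 * (r * u) * (r ^ 2 * D ^ 2) = 2 * r * D := by rw [hu]; field_simp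
    rw [a4]
    calc _ ≤ y ^ 2 * 1 := by gcongr
      _ ≤ _ := by linarith
  have pY1 : (2 * y / r ^ 2 - Dy) ^ 2 ≤ 8 + 4 * (r * u) := by
    have : (2 * y / r ^ 2) ^ 2 ≤ 4 := by
      have := sq_le_sq' (abs_le.1 h2y).1 (abs_le.1 h2y).2; linarith
    nlinarith [sq_nonneg (2 * y / r ^ 2 + Dy)]
  have pY2 : 2 / r ^ 2 - 4 * y ^ 2 / r ^ 4
      - (x ^ 2 / r ^ 3 + 8 * y ^ 2 / r ^ 6 - 2 / r ^ 4) / D + Dy ^ 2 ≤ 4 + 2 * (r * u) := by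
    have a1 : 0 ≤ 4 * y ^ 2 / r ^ 4 := by positivity
    have a2 : 0 ≤ (x ^ 2 / r ^ 3 + 8 * y ^ 2 / r ^ 6) / D := by positivity
    rw [sub_div]; linarith
  set Lx := 2 * x / r ^ 2 - Dx
  set Ly := 2 * y / r ^ 2 - Dy
  set Lxx := 2 / r ^ 2 - 4 * x ^ 2 / r ^ 4
      - (y ^ 2 / r ^ 3 + 8 * x ^ 2 / r ^ 6 - 2 / r ^ 4) / D + Dx ^ 2
  set Lyy := 2 / r ^ 2 - 4 * y ^ 2 / r ^ 4
      - (x ^ 2 / r ^ 3 + 8 * y ^ 2 / r ^ 6 - 2 / r ^ 4) / D + Dy ^ 2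
  have hru : 0 < r * u := by positivity
  have hdd : d ^ 2 ≤ 1 := by nlinarith
  have q1 : (d * Lx) ^ 2 + d * Lxx ≤ 38 := by
    have : d ^ 2 * Lx ^ 2 ≤ 1 * 25 := by gcongr
    nlinarith
  have q2 : (d * Ly) ^ 2 + d * Lyy ≤ 12 + 6 * (r * u) := by
    have : d ^ 2 * Ly ^ 2 ≤ 1 * (8 + 4 * (r * u)) := by gcongr
    nlinarith
  have q3 : d * ((r + 4 * x) * u) ≤ 5 * (r * u) := by
    have : (r + 4 * x) * u ≤ 5 * (r * u) := by nlinarith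
    nlinarith
  have q4 := mul_le_mul_of_nonneg_left q1 hσx
  have q5 := mul_le_mul_of_nonneg_left q2 hσy
  have q6 : d * ((x ^ 2 - y ^ 2) * Lx + 2 * x * y * Ly) + σx * ((d * Lx) ^ 2 + d * Lxx)
      + σy * ((d * Ly) ^ 2 + d * Lyy) ≤ -d * r + (5 + 6 * σy) * (r * u) + (38 * σx + 12 * σy) := by
    rw [pA]; nlinarith
  have := mul_le_mul_of_nonneg_left q6 hE.le
  refine le_trans (le_of_eq ?_) this
  ring

lemma LL_bounds (x y : ℝ) (h : 1 ≤ rr x y) :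
    Real.log (rr x y / 3) ≤ LL x y ∧ LL x y ≤ 4 * Real.log (rr x y) := by
  obtain ⟨e2, hx, hD, hD1, hD3, hDr, hDe⟩ := DD_facts x y h
  have hr : 0 < rr x y := by linarith
  unfold LL
  rw [← e2, Real.log_pow]
  have h1 : Real.log (DD x y) ≤ Real.log 3 + Real.log (rr x y) := by
    rw [← Real.log_mul (by norm_num) hr.ne']; exact Real.log_le_log hD hD3
  have h2 : 0 ≤ 2 * Real.log (rr x y) + Real.log (DD x y) := by
    have := Real.log_nonneg hD1
    rw [Real.log_mul (by positivity) hD.ne', Real.log_pow] at this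
    exact_mod_cast this
  rw [Real.log_div hr.ne' (by norm_num)]
  push_cast
  constructor <;> linarith

lemma absorb (d k M x y : ℝ) (hd : 0 < d) (hk : 0 < k) (hM : 1 ≤ M) (hr : 2 * M ≤ rr x y) :
    V1 d x y * (rr x y * (1 / (rr x y ^ 2 * DD x y))) ≤ (1 / M) * (rr x y * V1 d x y) +
      Real.exp (6 * M * k) * (Real.exp (Real.arsinh x) * FF (4 * d) k x y) := by
  have h1 : 1 ≤ rr x y := by linarith
  obtain ⟨e2, hx, hD, hD1, hD3, hDr, hDe⟩ := DD_facts x y h1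
  have hLL := (LL_bounds x y h1).2
  have hV : V1 d x y = Real.exp (d * LL x y) := V1_eq d x y (by nlinarith)
  have hV0 : 0 < V1 d x y := by rw [hV]; positivity
  obtain ⟨hρ0, hs1, hs2, h3, h4⟩ := rho_facts x _ _ rfl rfl
  have hF := FF_pos (4 * d) k x y
  have hFdef : FF (4 * d) k x y = Real.exp (4 * d * Real.arsinh x
    + -k * y ^ 2 * Real.exp (Real.arsinh x)) := rfl
  have ha : Real.log (Real.exp (Real.arsinh x)) = Real.arsinh x := Real.log_exp _
  set ρ := Real.exp (Real.arsinh x)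
  set s := √(1 + x ^ 2)
  set r := rr x y
  set D := DD x y
  have hr0 : 0 < r := by linarith
  have hxr := abs_le.1 hx
  rcases le_total M (r ^ 2 * D) with hc | hc
  · have : 1 / (r ^ 2 * D) ≤ 1 / M := one_div_le_one_div_of_le (by linarith) hc
    have h5 : V1 d x y * (r * (1 / (r ^ 2 * D))) ≤ V1 d x y * (r * (1 / M)) := by gcongr
    have h6 : 0 < Real.exp (6 * M * k) * (ρ * FF (4 * d) k x y) := by positivity
    linarith
  · have hy : y ^ 2 * r ≤ 2 * M := by
      have : y ^ 2 ≤ 2 * r * D := by nlinarith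
      nlinarith
    have hs : s ≤ 1 + r := Real.sqrt_le_iff.2 ⟨by linarith, by nlinarith [sq_nonneg y]⟩
    have hρ3 : ρ ≤ 3 * r := by linarith
    have hρy : ρ * y ^ 2 ≤ 6 * M := by nlinarith [sq_nonneg y]
    have hDx : D ≤ r / 2 := by
      have : r ^ 2 * D ≤ r ^ 2 * (r / 2) := by nlinarith [sq_nonneg r]
      exact le_of_mul_le_mul_left this (by positivity)
    have hxs : x ≤ s := (le_abs_self x).trans (Real.abs_le_sqrt (by linarith))
    have hρr : r ≤ ρ := by linarith
    have hlog : Real.log r ≤ Real.arsinh x := by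
      rw [← ha]; exact Real.log_le_log hr0 hρr
    have hu1 : 1 / (r ^ 2 * D) ≤ 1 := by rw [div_le_one (by positivity)]; exact hD1
    have h5 : V1 d x y ≤ Real.exp (6 * M * k) * FF (4 * d) k x y := by
      rw [hV, hFdef, ← Real.exp_add]
      apply Real.exp_le_exp.2
      have : d * LL x y ≤ d * (4 * Real.arsinh x) := by gcongr; linarith
      have : k * (ρ * y ^ 2) ≤ k * (6 * M) := by gcongr
      linarith
    have h6 : V1 d x y * (r * (1 / (r ^ 2 * D))) ≤
        (Real.exp (6 * M * k) * FF (4 * d) k x y) * (ρ * 1) := by gcongr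
    have h7 : 0 < (1 / M) * (r * V1 d x y) := by positivity
    linarith

lemma FF_contDiff (q k : ℝ) : ContDiff ℝ 2 (fun p : ℝ × ℝ => FF q k p.1 p.2) := by
  unfold FF
  have h : ContDiff ℝ 2 (fun p : ℝ × ℝ => Real.arsinh p.1) :=
    Real.contDiff_arsinh.comp contDiff_fst
  fun_prop

lemma V1_contDiff (d : ℝ) : ContDiff ℝ 2 (fun p : ℝ × ℝ => V1 d p.1 p.2) := by
  rw [contDiff_iff_contDiffAt]
  rintro ⟨x, y⟩
  rcases lt_or_ge (x ^ 2 + y ^ 2) 1 with h | h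
  · have : ∀ᶠ p : ℝ × ℝ in 𝓝 (x, y), p.1 ^ 2 + p.2 ^ 2 < 1 :=
      (Continuous.tendsto (by fun_prop : Continuous fun p : ℝ × ℝ => p.1 ^ 2 + p.2 ^ 2)
        (x, y)).eventually_lt_const h
    refine (contDiffAt_const (c := (0 : ℝ))).congr_of_eventuallyEq ?_
    filter_upwards [this] with p hp
    unfold V1
    rw [Real.smoothTransition.zero_of_nonpos (by linarith), zero_mul]
  · have h1 : 1 ≤ rr x y := Real.one_le_sqrt.2 h
    have hD := (DD_facts x y h1).2.2.1
    have hs : ContDiffAt ℝ 2 (fun p : ℝ × ℝ => p.1 ^ 2 + p.2 ^ 2) (x, y) := by fun_prop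
    have hn : x ^ 2 + y ^ 2 ≠ 0 := by positivity
    have hr : ContDiffAt ℝ 2 (fun p : ℝ × ℝ => rr p.1 p.2) (x, y) := hs.sqrt hn
    have hDD : ContDiffAt ℝ 2 (fun p : ℝ × ℝ => DD p.1 p.2) (x, y) :=
      (hr.sub contDiffAt_fst).add (hs.inv hn)
    have hLL : ContDiffAt ℝ 2 (fun p : ℝ × ℝ => LL p.1 p.2) (x, y) :=
      (hs.log hn).sub (hDD.log hD.ne')
    have hT : ContDiffAt ℝ 2 (fun p : ℝ × ℝ => Real.smoothTransition (p.1 ^ 2 + p.2 ^ 2 - 1))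
        (x, y) :=
      (Real.smoothTransition.contDiff.contDiffAt).comp (x, y) (hs.sub contDiffAt_const)
    exact hT.mul ((contDiffAt_const.mul hLL).exp)

lemma D2.of_contDiff {f : ℝ → ℝ} (h : ContDiff ℝ 2 f) (x : ℝ) :
    D2 f x (deriv f x) (deriv (deriv f) x) := by
  refine ⟨deriv f, Eventually.of_forall fun z => ?_, rfl, ?_⟩
  · exact ((h.differentiable (by norm_num)) z).hasDerivAt
  · have h' : ContDiff ℝ 1 (deriv f) := by
      have : ContDiff ℝ (1 + 1) f := by norm_num; exact h
      exact (contDiff_succ_iff_deriv.1 this).2.2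
    exact ((h'.differentiable (by norm_num)) x).hasDerivAt

lemma gen_add (σx σy A : ℝ) (V W : ℝ → ℝ → ℝ)
    (hV : ContDiff ℝ 2 (fun p : ℝ × ℝ => V p.1 p.2))
    (hW : ContDiff ℝ 2 (fun p : ℝ × ℝ => W p.1 p.2)) (x y : ℝ) :
    gen σx σy (fun x y => V x y + A * W x y) x y = gen σx σy V x y + A * gen σx σy W x y := by
  have sx : ∀ U : ℝ → ℝ → ℝ, ContDiff ℝ 2 (fun p : ℝ × ℝ => U p.1 p.2) →
      ContDiff ℝ 2 (fun x' => U x' y) := fun U hU =>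
    hU.comp (contDiff_id.prodMk contDiff_const)
  have sy : ∀ U : ℝ → ℝ → ℝ, ContDiff ℝ 2 (fun p : ℝ × ℝ => U p.1 p.2) →
      ContDiff ℝ 2 (fun y' => U x y') := fun U hU =>
    hU.comp (contDiff_const.prodMk contDiff_id)
  have h1 := (D2.of_contDiff (sx V hV) x).add ((D2.of_contDiff (sx W hW) x).const_mul A)
  have h2 := (D2.of_contDiff (sy V hV) y).add ((D2.of_contDiff (sy W hW) y).const_mul A)
  unfold gen
  rw [h1.deriv1, h1.deriv2, h2.deriv1, h2.deriv2]
  ring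

lemma gen_continuous (σx σy : ℝ) (V : ℝ → ℝ → ℝ)
    (hV : ContDiff ℝ 2 (fun p : ℝ × ℝ => V p.1 p.2)) :
    Continuous (fun p : ℝ × ℝ => gen σx σy V p.1 p.2) := by
  have key : ∀ U : ℝ → ℝ → ℝ, ContDiff ℝ 1 (fun p : ℝ × ℝ => U p.1 p.2) → ∀ x y,
      deriv (fun x' => U x' y) x = fderiv ℝ (fun p : ℝ × ℝ => U p.1 p.2) (x, y) (1, 0) ∧
      deriv (fun y' => U x y') y = fderiv ℝ (fun p : ℝ × ℝ => U p.1 p.2) (x, y) (0, 1) := by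
    intro U hU x y
    have hd := ((hU.differentiable (by norm_num)) (x, y)).hasFDerivAt
    constructor
    · exact (hd.comp_hasDerivAt x ((hasDerivAt_id x).prodMk (hasDerivAt_const x y))).deriv
    · exact (hd.comp_hasDerivAt y ((hasDerivAt_const y x).prodMk (hasDerivAt_id y))).deriv
  have hV1 : ContDiff ℝ 1 (fun p : ℝ × ℝ => V p.1 p.2) := hV.of_le (by norm_num)
  have hd : ∀ v : ℝ × ℝ, ContDiff ℝ 1
      (fun p : ℝ × ℝ => fderiv ℝ (fun p : ℝ × ℝ => V p.1 p.2) p v) := fun v =>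
    (hV.fderiv_right (m := 1) (by norm_num)).clm_apply contDiff_const
  have hc : ∀ U : ℝ × ℝ → ℝ, ContDiff ℝ 1 U → ∀ v : ℝ × ℝ,
      Continuous (fun p : ℝ × ℝ => fderiv ℝ U p v) := fun U hU v =>
    (hU.continuous_fderiv (by norm_num)).clm_apply continuous_const
  have ex : ∀ y, deriv (fun x' => V x' y) =
      fun x => fderiv ℝ (fun p : ℝ × ℝ => V p.1 p.2) (x, y) (1, 0) := fun y => by
    ext x; exact (key V hV1 x y).1
  have ey : ∀ x, deriv (fun y' => V x y') =
      fun y => fderiv ℝ (fun p : ℝ × ℝ => V p.1 p.2) (x, y) (0, 1) := fun x => by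
    ext y; exact (key V hV1 x y).2
  unfold gen
  simp only [ex, ey]
  have e1 := fun x y => (key (fun x y =>
    fderiv ℝ (fun p : ℝ × ℝ => V p.1 p.2) (x, y) (1, 0)) (hd (1, 0)) x y).1
  have e2 := fun x y => (key (fun x y =>
    fderiv ℝ (fun p : ℝ × ℝ => V p.1 p.2) (x, y) (0, 1)) (hd (0, 1)) x y).2
  simp only [e1, e2]
  have c1 := hc _ hV1 (1, 0)
  have c2 := hc _ hV1 (0, 1)
  have c3 := hc _ (hd (1, 0)) (1, 0)
  have c4 := hc _ (hd (0, 1)) (0, 1)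
  simp only [Prod.mk.eta] at *
  exact ((((continuous_fst.pow 2).sub (continuous_snd.pow 2)).mul c1).add
    (((continuous_const.mul continuous_fst).mul continuous_snd).mul c2)).add
    (continuous_const.mul c3) |>.add (continuous_const.mul c4)

lemma main_abs (σx σy δ p γ : ℝ) (hδ : 0 < δ) (hp : 0 < p) (hγ : γ = 1 + 1 / p)
    (V : ℝ → ℝ → ℝ) (hV : ContDiff ℝ 2 (fun p : ℝ × ℝ => V p.1 p.2))
    (hpos : ∀ x y, 0 < V x y) (R c0 C0 m0 : ℝ) (hR : 1 ≤ R) (hc0 : 0 < c0) (hC0 : 0 < C0)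
    (hm0 : 0 < m0)
    (hlow : ∀ x y, R ≤ rr x y → c0 * rr x y ^ δ ≤ V x y)
    (hup : ∀ x y, R ≤ rr x y → V x y ≤ C0 * (1 + rr x y) ^ p)
    (hL : ∀ x y, R ≤ rr x y → gen σx σy V x y ≤ -m0 * (rr x y * V x y)) :
    ∃ c C m b : ℝ, 0 < c ∧ 0 < C ∧ 0 < m ∧ 0 < b ∧
      (∀ x y : ℝ, 0 < V x y) ∧
      (∀ x y : ℝ, c * (rr x y) ^ δ ≤ V x y ∧ V x y ≤ C * (1 + rr x y) ^ p) ∧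
      (∀ x y : ℝ, gen σx σy V x y ≤ -m * (V x y) ^ γ + b) := by
  have hcomp : IsCompact (Set.Icc (-R) R ×ˢ Set.Icc (-R) R : Set (ℝ × ℝ)) :=
    isCompact_Icc.prod isCompact_Icc
  have hmem : ∀ x y, rr x y ≤ R → ((x, y) : ℝ × ℝ) ∈
      (Set.Icc (-R) R ×ˢ Set.Icc (-R) R : Set (ℝ × ℝ)) := by
    intro x y h
    have hx : |x| ≤ rr x y := Real.abs_le_sqrt (by nlinarith [sq_nonneg y])
    have hy : |y| ≤ rr x y := Real.abs_le_sqrt (by nlinarith [sq_nonneg x])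
    exact ⟨abs_le.1 (hx.trans h), abs_le.1 (hy.trans h)⟩
  have hVc := hV.continuous
  have hVinv : Continuous (fun p : ℝ × ℝ => (V p.1 p.2)⁻¹) :=
    hVc.inv₀ fun p => (hpos _ _).ne'
  have hVγ : Continuous (fun p : ℝ × ℝ => (V p.1 p.2) ^ γ) :=
    hVc.rpow_const fun p => Or.inl (hpos _ _).ne'
  have bd : ∀ f : ℝ × ℝ → ℝ, Continuous f → ∃ B, 0 < B ∧ ∀ x y, rr x y ≤ R → f (x, y) ≤ B := by
    intro f hf
    obtain ⟨B, hB⟩ := hcomp.bddAbove_image hf.continuousOn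
    exact ⟨max B 1, by positivity, fun x y h =>
      (hB (Set.mem_image_of_mem f (hmem x y h))).trans (le_max_left _ _)⟩
  obtain ⟨B1, hB1, hb1⟩ := bd _ hVc
  obtain ⟨B2, hB2, hb2⟩ := bd _ hVinv
  obtain ⟨B3, hB3, hb3⟩ := bd _ hVγ
  obtain ⟨B4, hB4, hb4⟩ := bd _ (gen_continuous σx σy V hV)
  have hr0 : ∀ x y, 0 ≤ rr x y := fun x y => Real.sqrt_nonneg _
  have hRδ : 0 < R ^ δ := by positivity
  set K := 2 * C0 ^ (1 / p) with hK
  have hK0 : 0 < K := by positivity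
  refine ⟨min c0 (1 / (B2 * R ^ δ)), max C0 B1, m0 / K, B4 + m0 / K * B3, by positivity,
    by positivity, by positivity, by positivity, hpos, fun x y => ⟨?_, ?_⟩, fun x y => ?_⟩
  · have hrδ : 0 ≤ rr x y ^ δ := Real.rpow_nonneg (hr0 x y) _
    rcases le_total R (rr x y) with h | h
    · refine le_trans ?_ (hlow x y h)
      gcongr; exact min_le_left _ _
    · have h1 : rr x y ^ δ ≤ R ^ δ := Real.rpow_le_rpow (hr0 x y) h hδ.le
      have h2 : 1 / B2 ≤ V x y := by
        have := hb2 x y h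
        rw [one_div]; exact inv_le_of_inv_le₀ (hpos x y) this
      calc _ ≤ 1 / (B2 * R ^ δ) * R ^ δ := by
            gcongr; exact min_le_right _ _
        _ = 1 / B2 := by field_simp
        _ ≤ _ := h2
  · rcases le_total R (rr x y) with h | h
    · refine (hup x y h).trans ?_
      have := hr0 x y
      gcongr; exact le_max_left _ _
    · have h1 : 1 ≤ (1 + rr x y) ^ p := Real.one_le_rpow (by linarith [hr0 x y]) hp.le
      calc V x y ≤ B1 * 1 := by simpa using hb1 x y h
        _ ≤ _ := by gcongr; exact le_max_right _ _
  · have hVp := hpos x y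
    rcases le_total R (rr x y) with h | h
    · have h1 : V x y ^ γ = V x y * V x y ^ (1 / p) := by
        rw [hγ, Real.rpow_add hVp, Real.rpow_one]
      have h0 := hr0 x y
      have h2 : V x y ^ (1 / p) ≤ K * rr x y := by
        calc V x y ^ (1 / p) ≤ (C0 * (1 + rr x y) ^ p) ^ (1 / p) :=
              Real.rpow_le_rpow hVp.le (hup x y h) (by positivity)
          _ = C0 ^ (1 / p) * (1 + rr x y) := by
              rw [Real.mul_rpow hC0.le (by positivity), ← Real.rpow_mul (by positivity),
                mul_one_div_cancel hp.ne', Real.rpow_one]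
          _ ≤ C0 ^ (1 / p) * (2 * rr x y) := by gcongr; linarith
          _ = _ := by rw [hK]; ring
      have h3 : m0 / K * V x y ^ γ ≤ m0 * (rr x y * V x y) := by
        rw [h1]
        calc _ ≤ m0 / K * (V x y * (K * rr x y)) := by gcongr
          _ = _ := by field_simp
      have h4 := hL x y h
      have h5 : 0 < m0 / K * B3 := by positivity
      linarith
    · have h1 := hb4 x y h
      have h2 := hb3 x y h
      have h3 : m0 / K * V x y ^ γ ≤ m0 / K * B3 := by gcongr
      simp only at h1
      linarith

lemma V1_low (δ x y : ℝ) (hδ : 0 < δ) (h : 2 ≤ rr x y) : (rr x y / 3) ^ δ ≤ V1 δ x y := by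
  have h1 : 1 ≤ rr x y := by linarith
  have e2 := (DD_facts x y h1).1
  rw [V1_eq δ x y (by nlinarith), Real.rpow_def_of_pos (by linarith)]
  apply Real.exp_le_exp.2
  have := (LL_bounds x y h1).1
  nlinarith

lemma V1_up (δ p x y : ℝ) (hδ : 0 < δ) (hp : 4 * δ ≤ p) (h : 2 ≤ rr x y) :
    V1 δ x y ≤ (1 + rr x y) ^ p := by
  have h1 : 1 ≤ rr x y := by linarith
  have e2 := (DD_facts x y h1).1
  rw [V1_eq δ x y (by nlinarith), Real.rpow_def_of_pos (by linarith)]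
  apply Real.exp_le_exp.2
  have h2 := (LL_bounds x y h1).2
  have h3 : Real.log (rr x y) ≤ Real.log (1 + rr x y) := Real.log_le_log (by linarith) (by linarith)
  have h4 : 0 ≤ Real.log (rr x y) := Real.log_nonneg h1
  have h5 : δ * LL x y ≤ δ * (4 * Real.log (rr x y)) := by gcongr
  have h6 : 4 * δ * Real.log (rr x y) ≤ p * Real.log (1 + rr x y) := by gcongr; linarith
  linarith

lemma FF_up (δ k p x y : ℝ) (hδ : 0 < δ) (hk : 0 < k) (hp : 4 * δ ≤ p) :
    FF (4 * δ) k x y ≤ 2 ^ p * (1 + rr x y) ^ p := by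
  have hr : 0 ≤ rr x y := Real.sqrt_nonneg _
  rw [← Real.mul_rpow (by norm_num) (by linarith), Real.rpow_def_of_pos (by linarith)]
  apply Real.exp_le_exp.2
  obtain ⟨hρ0, hs1, hs2, h3, h4⟩ := rho_facts x _ _ rfl rfl
  have e2 : rr x y ^ 2 = x ^ 2 + y ^ 2 := Real.sq_sqrt (by positivity)
  have hx : |x| ≤ rr x y := Real.abs_le_sqrt (by nlinarith [sq_nonneg y])
  have hs : √(1 + x ^ 2) ≤ 1 + rr x y :=
    Real.sqrt_le_iff.2 ⟨by linarith, by nlinarith [sq_nonneg y]⟩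
  have h5 : Real.arsinh x ≤ Real.log (2 * (1 + rr x y)) := by
    rw [← Real.log_exp (Real.arsinh x)]
    exact Real.log_le_log hρ0 (by linarith [le_abs_self x])
  have h6 : 0 ≤ Real.log (2 * (1 + rr x y)) := Real.log_nonneg (by linarith)
  have h7 : 0 ≤ k * y ^ 2 * Real.exp (Real.arsinh x) := by positivity
  have h8 : 4 * δ * Real.arsinh x ≤ 4 * δ * Real.log (2 * (1 + rr x y)) := by gcongr
  have h9 : 4 * δ * Real.log (2 * (1 + rr x y)) ≤ p * Real.log (2 * (1 + rr x y)) := by gcongr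
  linarith


set_option maxHeartbeats 2000000 in
/-- Existence of a global super Lyapunov function for the planar SDE
`dX = (X²−Y²)dt + √(2σx)dW¹`, `dY = 2XY dt + √(2σy)dW²`:
for `δ ∈ (0, 2/5)` and `γ = (5δ+5)/(5δ+3)` there exists a positive `C²` function
`V` with polynomial upper and lower bounds whose image under the generator
`L = (x²−y²)∂ₓ + 2xy∂_y + σx ∂ₓₓ + σy ∂_yy` satisfies `LV ≤ −m V^γ + b`. -/
theorem stmt_0 (σx σy δ γ : ℝ) (hσx : 0 ≤ σx) (hσy : 0 < σy)
    (hδ : δ ∈ Set.Ioo (0 : ℝ) (2/5)) (hγ : γ = (5*δ+5)/(5*δ+3)) :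
    ∃ V : ℝ → ℝ → ℝ, ContDiff ℝ 2 (fun p : ℝ × ℝ => V p.1 p.2) ∧
      ∃ c C m b : ℝ, 0 < c ∧ 0 < C ∧ 0 < m ∧ 0 < b ∧
        (∀ x y : ℝ, 0 < V x y) ∧
        (∀ x y : ℝ, c * (Real.sqrt (x^2 + y^2)) ^ δ ≤ V x y ∧
            V x y ≤ C * (1 + Real.sqrt (x^2 + y^2)) ^ ((5*δ+3)/2)) ∧
        (∀ x y : ℝ,
          (x^2 - y^2) * deriv (fun x' => V x' y) x
            + 2*x*y * deriv (fun y' => V x y') y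
            + σx * deriv (deriv (fun x' => V x' y)) x
            + σy * deriv (deriv (fun y' => V x y')) y
            ≤ -m * (V x y) ^ γ + b) := by
  obtain ⟨hδ0, hδ1⟩ := hδ
  change ∃ V : ℝ → ℝ → ℝ, ContDiff ℝ 2 (fun p : ℝ × ℝ => V p.1 p.2) ∧
      ∃ c C m b : ℝ, 0 < c ∧ 0 < C ∧ 0 < m ∧ 0 < b ∧
        (∀ x y : ℝ, 0 < V x y) ∧
        (∀ x y : ℝ, c * (rr x y) ^ δ ≤ V x y ∧
            V x y ≤ C * (1 + rr x y) ^ ((5*δ+3)/2)) ∧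
        (∀ x y : ℝ, gen σx σy V x y ≤ -m * (V x y) ^ γ + b)
  set p := (5 * δ + 3) / 2 with hp
  have hp0 : 0 < p := by rw [hp]; linarith
  have h4p : 4 * δ ≤ p := by rw [hp]; linarith
  have hγ' : γ = 1 + 1 / p := by rw [hγ, hp]; field_simp; ring
  set k := 1 / (2 * σy) with hk
  have hk0 : 0 < k := by positivity
  have hkσ : k * σy = 1 / 2 := by rw [hk]; field_simp
  set a := 1 - 2 * δ with ha
  have ha0 : 0 < a := by rw [ha]; linarith
  set C1 := 5 + 6 * σy with hC1
  have hC1p : 0 < C1 := by positivity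
  set C2 := 38 * σx + 12 * σy with hC2
  have hC2p : 0 < C2 := by positivity
  set M := max 1 (2 * C1 / δ) with hM
  have hM1 : 1 ≤ M := le_max_left _ _
  have hM0 : 0 < M := by linarith
  have hM2 : C1 * (1 / M) ≤ δ / 2 := by
    have : 2 * C1 / δ ≤ M := le_max_right _ _
    rw [div_le_iff₀ hδ0] at this
    rw [mul_one_div, div_le_iff₀ hM0]; linarith
  set E := Real.exp (6 * M * k) with hE
  have hE0 : 0 < E := Real.exp_pos _
  set A := 2 * C1 * E / a with hA
  have hA0 : 0 < A := by positivity
  have hAa : A * (a / 2) = C1 * E := by rw [hA]; field_simp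
  set C5 := 8 * (4 + 1 / k + 12 * σx) + a / 4 * (8 * (2 + 1 / k)) with hC5
  have hC5p : 0 < C5 := by positivity
  set m1 := min (δ / 2) (a / 4) with hm1
  have hm0 : 0 < m1 := by positivity
  have hm2 : m1 ≤ δ / 2 := min_le_left _ _
  have hm3 : m1 ≤ a / 4 := min_le_right _ _
  set T := 8 * A * C5 / m1 with hT
  have hT0 : 0 < T := by positivity
  set R := max (2 * M) (max (4 * C2 / m1) (3 * T ^ (1 / δ))) with hR
  have hR1 : 2 * M ≤ R := le_max_left _ _
  have hR2 : 4 * C2 / m1 ≤ R := (le_max_left _ _).trans (le_max_right _ _)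
  have hR3 : 3 * T ^ (1 / δ) ≤ R := (le_max_right _ _).trans (le_max_right _ _)
  have hV1n : ∀ x y, 0 ≤ V1 δ x y := fun x y =>
    mul_nonneg (Real.smoothTransition.nonneg _) (Real.exp_pos _).le
  have hVc : ContDiff ℝ 2 (fun p : ℝ × ℝ => V1 δ p.1 p.2 + A * FF (4 * δ) k p.1 p.2) :=
    (V1_contDiff δ).add (contDiff_const.mul (FF_contDiff (4 * δ) k))
  refine ⟨fun x y => V1 δ x y + A * FF (4 * δ) k x y, hVc, ?_⟩
  refine main_abs σx σy δ p γ hδ0 hp0 hγ' _ hVc ?_ R ((1 / 3) ^ δ) (1 + A * 2 ^ p) (m1 / 2)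
    (by linarith) (by positivity) (by positivity) (by positivity) ?_ ?_ ?_
  · intro x y
    have := hV1n x y
    have := FF_pos (4 * δ) k x y
    positivity
  · intro x y h
    have h1 := V1_low δ x y hδ0 (by linarith)
    have h2 : 0 < A * FF (4 * δ) k x y := mul_pos hA0 (FF_pos _ _ _ _)
    rw [← Real.mul_rpow (by norm_num) (by linarith)]
    have e : 1 / 3 * rr x y = rr x y / 3 := by ring
    rw [e]; linarith
  · intro x y h
    have h1 := V1_up δ p x y hδ0 h4p (by linarith)
    have h2 := mul_le_mul_of_nonneg_left (FF_up δ k p x y hδ0 hk0 h4p) hA0.le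
    linarith
  · intro x y h
    have hr2 : 2 ≤ rr x y := by linarith
    rw [gen_add σx σy A _ _ (V1_contDiff δ) (FF_contDiff (4 * δ) k) x y]
    have g1 := gen_V1 σx σy δ x y hσx hσy.le hδ0 (by linarith) hr2
    have g2 := gen_FF σx σy (4 * δ) k x y hσx hk0 hkσ (by linarith) (by linarith)
    have g3 := FF_rr (4 * δ) k x y hk0 (by linarith) (by linarith)
    have g4 := absorb δ k M x y hδ0 hk0 hM1 (by linarith)
    have hlow := V1_low δ x y hδ0 hr2
    have hVn := hV1n x y
    have hF := FF_pos (4 * δ) k x y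
    have hTV : T ≤ V1 δ x y := by
      refine le_trans ?_ hlow
      have : T ^ (1 / δ) ≤ rr x y / 3 := by linarith
      calc T = (T ^ (1 / δ)) ^ δ := by
            rw [← Real.rpow_mul hT0.le, one_div_mul_cancel hδ0.ne', Real.rpow_one]
        _ ≤ _ := Real.rpow_le_rpow (by positivity) this hδ0.le
    set r := rr x y
    set v := V1 δ x y
    set F := FF (4 * δ) k x y
    set ρF := Real.exp (Real.arsinh x) * F
    set w := v * (r * (1 / (r ^ 2 * DD x y)))
    have g2' : gen σx σy (FF (4 * δ) k) x y ≤ -(a / 2) * ρF - a / 4 * (r * F) + C5 * (1 + r) := by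
      have := mul_le_mul_of_nonneg_left g3 (by positivity : 0 ≤ a / 4)
      have e : 1 - 4 * δ / 2 = a := by rw [ha]; ring
      rw [e] at g2
      rw [hC5]; linarith
    have g2A := mul_le_mul_of_nonneg_left g2' hA0.le
    have g1' : gen σx σy (V1 δ) x y ≤ -δ * (r * v) + C1 * w + C2 * v := by
      refine g1.trans (le_of_eq ?_); ring
    have g4' := mul_le_mul_of_nonneg_left g4 hC1p.le
    have g5 : C1 * w ≤ δ / 2 * (r * v) + A * (a / 2) * ρF := by
      have : C1 * (1 / M) * (r * v) ≤ δ / 2 * (r * v) := by gcongr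
      rw [hAa]; linarith
    have g6 : C2 * v ≤ m1 / 4 * (r * v) := by
      rw [div_le_iff₀ hm0] at hR2
      have e0 := mul_le_mul_of_nonneg_right h hm0.le
      have : C2 ≤ m1 / 4 * r := by linarith
      have := mul_le_mul_of_nonneg_right this hVn
      linarith
    have g7 : A * (C5 * (1 + r)) ≤ m1 / 4 * (r * v) := by
      rw [hT, div_le_iff₀ hm0] at hTV
      have e1 : A * (C5 * (1 + r)) ≤ A * (C5 * (2 * r)) := by gcongr; linarith
      have e2 := mul_le_mul_of_nonneg_left hTV (by linarith : 0 ≤ r)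
      linarith
    have g8 : m1 * (r * v) ≤ δ / 2 * (r * v) := by gcongr
    have g9 : m1 * (A * (r * F)) ≤ a / 4 * (A * (r * F)) := by gcongr
    have g10 : 0 ≤ m1 * (A * (r * F)) := by positivity
    linarith
end

section
/- Let σx, σy ≥ 0, α > 0 and δ ∈ (0, 2). Define v₁(x,y) = (x²+y²)^(δ/2), m₁ = αδ/(2√(α²+4)), γ₁ = (δ+1)/δ, and R₁ = (2(σx+σy)·√(α²+4)/α)^(1/3). Then for every (x,y) ∈ ℝ² satisfying x ≤ −α/2, |y| ≤ (2/α)|x| and x² + y² ≥ R₁², one has (x²−y²)·∂ₓv₁(x,y) + 2xy·∂_yv₁(x,y) + σx·∂²ₓₓv₁(x,y) + σy·∂²_yyv₁(x,y) ≤ −m₁·v₁(x,y)^γ₁. -/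
theorem aux_d1 (p d t : ℝ) (h : 0 < t^2 + d) :
    HasDerivAt (fun t : ℝ => (t^2 + d) ^ p) (2 * p * t * (t^2 + d) ^ (p - 1)) t := by
  have h1 : HasDerivAt (fun t : ℝ => t^2 + d) (2 * t) t := by
    simpa using (hasDerivAt_pow 2 t).add_const d
  convert h1.rpow_const (p := p) (Or.inl h.ne') using 1
  ring

theorem aux_d2 (p d t : ℝ) (h : 0 < t^2 + d) :
    deriv (deriv (fun t : ℝ => (t^2 + d) ^ p)) t
      = 2 * p * (t^2 + d) ^ (p - 1) + 4 * p * (p - 1) * t^2 * (t^2 + d) ^ (p - 2) := by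
  have hev : deriv (fun t : ℝ => (t^2 + d) ^ p)
      =ᶠ[nhds t] fun t => 2 * p * t * (t^2 + d) ^ (p - 1) := by
    have hc : ContinuousAt (fun t : ℝ => t^2 + d) t := by fun_prop
    filter_upwards [hc.eventually (lt_mem_nhds h)] with u hu
    exact (aux_d1 p d u hu).deriv
  rw [hev.deriv_eq]
  have h1 : HasDerivAt (fun t : ℝ => 2 * p * t) (2 * p) t := by
    simpa using (hasDerivAt_id t).const_mul (2 * p)
  have h2 := h1.mul (aux_d1 (p - 1) d t h)
  refine h2.deriv.trans ?_
  rw [show p - 1 - 1 = p - 2 by ring]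
  ring

theorem aux_d2_le (δ d t : ℝ) (hδ : δ ∈ Set.Ioo (0 : ℝ) 2) (h : 0 < t^2 + d) :
    deriv (deriv (fun t : ℝ => (t^2 + d) ^ (δ/2))) t ≤ δ * (t^2 + d) ^ (δ/2 - 1) := by
  rw [aux_d2 _ _ _ h]
  have h1 : 0 ≤ (t^2 + d) ^ (δ/2 - 2) := (Real.rpow_pos_of_pos h _).le
  have h2 : 0 ≤ δ * (2 - δ) * t^2 * (t^2 + d) ^ (δ/2 - 2) := by
    have := hδ.1.le
    have : 0 ≤ 2 - δ := by linarith [hδ.2]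
    positivity
  nlinarith

/-- The priming Lyapunov function `v₁(x,y) = (x²+y²)^(δ/2)` satisfies the super
Lyapunov estimate `L v₁ ≤ −m₁ v₁^γ₁` in the priming region
`{x ≤ −α/2, |y| ≤ (2/α)|x|}` outside the ball of radius `R₁`. -/
theorem stmt_1 (σx σy α δ : ℝ) (hσx : 0 ≤ σx) (hσy : 0 ≤ σy) (hα : 0 < α)
    (hδ : δ ∈ Set.Ioo (0 : ℝ) 2)
    (v₁ : ℝ → ℝ → ℝ) (hv₁ : ∀ x y : ℝ, v₁ x y = (x^2 + y^2) ^ (δ/2))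
    (m₁ γ₁ R₁ : ℝ)
    (hm₁ : m₁ = α*δ / (2 * Real.sqrt (α^2 + 4)))
    (hγ₁ : γ₁ = (δ+1)/δ)
    (hR₁ : R₁ = (2*(σx+σy) * Real.sqrt (α^2+4) / α) ^ ((1:ℝ)/3)) :
    ∀ x y : ℝ, x ≤ -α/2 → |y| ≤ (2/α) * |x| → R₁^2 ≤ x^2 + y^2 →
      (x^2 - y^2) * deriv (fun x' => v₁ x' y) x
        + 2*x*y * deriv (fun y' => v₁ x y') y
        + σx * deriv (deriv (fun x' => v₁ x' y)) x
        + σy * deriv (deriv (fun y' => v₁ x y')) y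
        ≤ -m₁ * (v₁ x y) ^ γ₁ := by
  intro x y hx hy hR
  have hδ0 := hδ.1
  have hx0 : x < 0 := by linarith
  have hs : 0 < x^2 + y^2 := by nlinarith [sq_nonneg y, mul_pos_of_neg_of_neg hx0 hx0]
  have hs' : 0 < y^2 + x^2 := by linarith
  have e1 : (fun x' => v₁ x' y) = fun t : ℝ => (t^2 + y^2) ^ (δ/2) := by
    funext t; exact hv₁ t y
  have e2 : (fun y' => v₁ x y') = fun t : ℝ => (t^2 + x^2) ^ (δ/2) := by
    funext t; rw [hv₁, add_comm]
  rw [e1, e2, hv₁ x y, (aux_d1 (δ/2) _ x hs).deriv, (aux_d1 (δ/2) _ y hs').deriv]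
  have b1 := mul_le_mul_of_nonneg_left (aux_d2_le δ (y^2) x hδ hs) hσx
  have b2 := mul_le_mul_of_nonneg_left (aux_d2_le δ (x^2) y hδ hs') hσy
  rw [add_comm (y^2) (x^2)] at b2 ⊢
  have hP : 0 < (x^2 + y^2) ^ (δ/2) := Real.rpow_pos_of_pos hs _
  have hQ : (x^2 + y^2) ^ (δ/2 - 1) * (x^2 + y^2) = (x^2 + y^2) ^ (δ/2) := by
    rw [Real.rpow_sub_one hs.ne']; field_simp
  have hQ0 : 0 < (x^2 + y^2) ^ (δ/2 - 1) := Real.rpow_pos_of_pos hs _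
  have hv : ((x^2 + y^2) ^ (δ/2)) ^ γ₁ = (x^2 + y^2) ^ (δ/2) * √(x^2 + y^2) := by
    rw [← Real.rpow_mul hs.le, hγ₁, Real.sqrt_eq_rpow, ← Real.rpow_add hs]
    congr 1; field_simp
  rw [hv]
  have hr : 0 < √(x^2 + y^2) := Real.sqrt_pos.2 hs
  have hr2 : √(x^2 + y^2) ^ 2 = x^2 + y^2 := Real.sq_sqrt hs.le
  have hq : 0 < √(α^2 + 4) := Real.sqrt_pos.2 (by positivity)
  have hq2 : √(α^2 + 4) ^ 2 = α^2 + 4 := Real.sq_sqrt (by positivity)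
  set r := √(x^2 + y^2) with hrdef
  set q := √(α^2 + 4) with hqdef
  set Q := (x^2 + y^2) ^ (δ/2 - 1) with hQdef
  -- angular bound
  have hya : α * |y| ≤ 2 * |x| := by
    calc α * |y| ≤ α * (2/α * |x|) := mul_le_mul_of_nonneg_left hy hα.le
      _ = 2 * |x| := by field_simp
  have hya2 : α^2 * y^2 ≤ 4 * x^2 := by
    have := pow_le_pow_left₀ (by positivity) hya 2
    rw [mul_pow, mul_pow, sq_abs, sq_abs] at this
    linarith
  have hang : α * r ≤ -x * q := by
    refine (abs_le_of_sq_le_sq' ?_ ?_).2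
    · rw [mul_pow, mul_pow, hr2, hq2]; nlinarith
    · exact mul_nonneg (by linarith) hq.le
  -- radius bound
  have hA : 0 ≤ 2*(σx+σy) * q / α := by positivity
  have hR0 : 0 ≤ R₁ := by rw [hR₁]; positivity
  have hR3 : R₁^3 = 2*(σx+σy) * q / α := by
    rw [hR₁, ← Real.rpow_natCast, ← Real.rpow_mul hA]; norm_num
  have hRr : R₁ ≤ r := Real.le_sqrt_of_sq_le hR
  have hr3 : 2*(σx+σy) * q ≤ α * r^3 := by
    have := pow_le_pow_left₀ hR0 hRr 3
    rw [hR3, div_le_iff₀ hα] at this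
    linarith
  -- conclusion
  have key : x * r^2 + (σx + σy) ≤ -(α / (2*q)) * r^3 := by
    have h1 : σx + σy ≤ α / (2*q) * r^3 := by
      rw [div_mul_eq_mul_div, le_div_iff₀ (by positivity)]; linarith
    have h2 : x * r^2 ≤ -(2 * (α / (2*q))) * r^3 := by
      have : x ≤ -(2 * (α / (2*q))) * r := by
        have : α / q * r ≤ -x := by
          rw [div_mul_eq_mul_div, div_le_iff₀ hq]; exact hang
        have e : 2 * (α / (2*q)) = α / q := by field_simp
        rw [e]; linarith
      nlinarith [mul_le_mul_of_nonneg_right this (sq_nonneg r)]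
    linarith
  have key2 := mul_le_mul_of_nonneg_left key (mul_pos hδ0 hQ0).le
  have hm : m₁ = δ * (α / (2*q)) := by rw [hm₁]; ring
  rw [← hQ, hm, ← hr2]
  have e3 : (x^2 - y^2) * (2 * (δ/2) * x * Q) + 2*x*y * (2 * (δ/2) * y * Q)
      = δ * Q * (x * r^2) := by rw [hr2]; ring
  have e4 : -(δ * (α / (2*q))) * (Q * r^2 * r) = δ * Q * (-(α / (2*q)) * r^3) := by ring
  rw [e4]
  linarith
end

section
/- Fix δ > 0, α > 0 and λ ∈ [0,1]. Define, for y ≠ 0, v₂(x,y,λ) = ((x²+λy²)/|y|)^δ · [ x/|y| + α√λ + √λ·(α²+1)^(−δ/2) ]. Then: (a) for every (x,y) with y ≠ 0, (x² − λy²)·∂ₓv₂(x,y,λ) + 2xy·∂_yv₂(x,y,λ) = −((x²+λy²)/|y|)^(δ+1); and (b) for every (x,y) with x ≤ −α√λ and |y| = |x|/(α√λ) (with λ > 0), v₂(x,y,λ) = λ^((δ+1)/2)·(x²+λy²)^(δ/2). -/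
/-- The explicit function `v₂(x,y,λ)` solves the Poisson equation
`T_λ v₂ = −((x²+λy²)/|y|)^(δ+1)` off the x-axis, and attains the boundary data
`λ^((δ+1)/2) (x²+λy²)^(δ/2)` on the curve `{x ≤ −α√λ, |y| = |x|/(α√λ)}`. -/
theorem stmt_2 (δ α lam : ℝ) (hδ : 0 < δ) (hα : 0 < α)
    (hlam : lam ∈ Set.Icc (0 : ℝ) 1)
    (v₂ : ℝ → ℝ → ℝ → ℝ)
    (hv₂ : ∀ x y l : ℝ, y ≠ 0 →
      v₂ x y l = ((x^2 + l*y^2) / |y|) ^ δ *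
        (x / |y| + α * Real.sqrt l + Real.sqrt l * (α^2 + 1) ^ (-(δ/2)))) :
    (∀ x y : ℝ, y ≠ 0 →
      (x^2 - lam*y^2) * deriv (fun x' => v₂ x' y lam) x
        + 2*x*y * deriv (fun y' => v₂ x y' lam) y
        = -(((x^2 + lam*y^2) / |y|) ^ (δ+1))) ∧
    (∀ x y : ℝ, 0 < lam → x ≤ -α * Real.sqrt lam →
      |y| = |x| / (α * Real.sqrt lam) →
      v₂ x y lam = lam ^ ((δ+1)/2) * (x^2 + lam*y^2) ^ (δ/2)) := by
  obtain ⟨hl0, hl1⟩ := hlam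
  constructor
  · intro x y hy
    have hay : 0 < |y| := abs_pos.mpr hy
    by_cases hN : x^2 + lam*y^2 = 0
    · have hy2 : 0 ≤ lam*y^2 := by positivity
      have hx : x = 0 := by
        have : x^2 = 0 := le_antisymm (by linarith) (sq_nonneg x)
        exact pow_eq_zero_iff (two_ne_zero) |>.mp this
      subst hx
      have h2 : lam * y^2 = 0 := by linarith
      rw [hN, zero_div, Real.zero_rpow (by linarith), h2]
      ring
    · have hNpos : 0 < x^2 + lam*y^2 := lt_of_le_of_ne (by positivity) (Ne.symm hN)
      have hH : 0 < (x^2 + lam*y^2) / |y| := by positivity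
      obtain ⟨s, hs, hsy, hsd⟩ : ∃ s : ℝ, s^2 = 1 ∧ y = s * |y| ∧
          HasDerivAt (fun z : ℝ => |z|) s y := by
        rcases lt_or_gt_of_ne hy with h | h
        · exact ⟨-1, by norm_num, by rw [abs_of_neg h]; ring, hasDerivAt_abs_neg h⟩
        · exact ⟨1, by norm_num, by rw [abs_of_pos h]; ring, hasDerivAt_abs_pos h⟩
      set c : ℝ := α * Real.sqrt lam with hc
      set d : ℝ := Real.sqrt lam * (α^2 + 1) ^ (-(δ/2)) with hd
      have e1 : (fun x' => v₂ x' y lam) =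
          fun x' => ((x'^2 + lam*y^2) / |y|) ^ δ * (x' / |y| + c + d) := by
        funext x'
        exact hv₂ x' y lam hy
      have e2 : (fun y' => v₂ x y' lam) =ᶠ[nhds y]
          fun y' => ((x^2 + lam*y'^2) / |y'|) ^ δ * (x / |y'| + c + d) := by
        filter_upwards [isOpen_ne.mem_nhds hy] with y' hy'
        exact hv₂ x y' lam hy'
      have d1 := (((((hasDerivAt_id x).pow 2).add_const (lam*y^2)).div_const |y|).rpow_const
        (p := δ) (Or.inl hH.ne')).mul
        ((((hasDerivAt_id x).div_const |y|).add_const c).add_const d)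
      have d2 := ((((((hasDerivAt_id y).pow 2).const_mul lam).const_add (x^2)).div hsd
        hay.ne').rpow_const (p := δ) (Or.inl hH.ne')).mul
        ((((hasDerivAt_const y x).div hsd hay.ne').add_const c).add_const d)
      have f1 := d1.deriv
      have f2 := d2.deriv
      rw [e1, e2.deriv_eq]
      refine (congrArg₂ (fun a b => (x^2 - lam*y^2) * a + 2*x*y * b) f1 f2).trans ?_
      simp only [id, Pi.pow_apply, Pi.div_apply]
      rw [Real.rpow_add_one hH.ne']
      generalize ((x^2 + lam*y^2) / |y|) ^ δ = P
      generalize ((x^2 + lam*y^2) / |y|) ^ (δ - 1) = Q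
      generalize |y| = r at *
      subst hsy
      field_simp
      norm_num
      linear_combination (-(2*x*(x^2+lam*s^2*r^2)*(δ*Q*(x+r*c+r*d))) - 2*x^2*r*P) * hs
  · intro x y hl hx hxy
    have hsl : 0 < Real.sqrt lam := Real.sqrt_pos.mpr hl
    have hk : 0 < α * Real.sqrt lam := by positivity
    have hx0 : x < 0 := by linarith
    have hay : 0 < |y| := by rw [hxy]; exact div_pos (abs_pos.mpr hx0.ne) hk
    have hy : y ≠ 0 := abs_pos.mp hay
    have hxe : x = -(α * Real.sqrt lam * |y|) := by
      rw [hxy, abs_of_neg hx0]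
      field_simp
    have hA : 0 < α^2 + 1 := by positivity
    have hN : x^2 + lam*y^2 = lam * |y|^2 * (α^2+1) := by
      rw [hxe, ← sq_abs y]
      have := Real.sq_sqrt hl0
      linear_combination α^2 * |y|^2 * this
    have hz : x / |y| + α * Real.sqrt lam = 0 := by
      have : x / |y| = -(α * Real.sqrt lam) := by
        rw [div_eq_iff hay.ne']; linarith
      linarith
    have hH : lam * |y|^2 * (α^2+1) / |y| = lam * |y| * (α^2+1) := by
      field_simp
    rw [hv₂ x y lam hy, hz, hN, hH, zero_add, Real.sqrt_eq_rpow,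
      Real.mul_rpow (by positivity) hA.le, Real.mul_rpow hl0 hay.le,
      Real.mul_rpow (by positivity) hA.le, Real.mul_rpow hl0 (by positivity)]
    have g1 : (|y|^2 : ℝ) ^ (δ/2) = |y| ^ δ := by
      rw [← Real.rpow_natCast, ← Real.rpow_mul hay.le]
      congr 1; push_cast; ring
    have g2 : (α^2+1) ^ δ * (α^2+1) ^ (-(δ/2)) = (α^2+1) ^ (δ/2) := by
      rw [← Real.rpow_add hA]; congr 1; ring
    have g3 : lam ^ δ * lam ^ ((1:ℝ)/2) = lam ^ ((δ+1)/2) * lam ^ (δ/2) := by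
      rw [← Real.rpow_add hl, ← Real.rpow_add hl]; congr 1; ring
    rw [g1]
    linear_combination (lam ^ δ * lam ^ ((1:ℝ)/2)) * |y| ^ δ * g2
      + |y| ^ δ * (α^2+1) ^ (δ/2) * g3
end

section
/- Let σ > 0, α > 0, δ̂ ∈ (0, 5/2) and c₁, c₂ > 0. Suppose g : ℝ → ℝ is C² and satisfies σ·g''(z) + (5/2)·z·g'(z) + δ̂·g(z) = 0 for all z with |z| ≤ √(2α), together with g(√(2α)) = g(−√(2α)) = 1. Define v₃(x,y) = x^δ̂·[ (c₁/δ̂ + c₂)·g(√x · y) − c₁/δ̂ ] for x > 0. Then for every (x,y) with x > 0 and x·y² ≤ 2α one has x²·∂ₓv₃(x,y) + 2xy·∂_yv₃(x,y) + σ·∂²_yyv₃(x,y) = −c₁·x^(δ̂+1); moreover v₃(x,y) = c₂·x^δ̂ whenever x·y² = 2α. -/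
/-- The function `v₃(x,y) = x^δ̂ ((c₁/δ̂ + c₂) g(√x y) − c₁/δ̂)`, built from a solution
`g` of the two-point boundary value problem `σ g'' + (5/2) z g' + δ̂ g = 0`,
`g(±√(2α)) = 1`, solves the Poisson equation `A v₃ = −c₁ x^(δ̂+1)` in the diffusive
region `{x > 0, x y² ≤ 2α}` with boundary data `c₂ x^δ̂` on `{x y² = 2α}`. -/
theorem stmt_4 (σ α δh c₁ c₂ : ℝ) (hσ : 0 < σ) (hα : 0 < α)
    (hδh : δh ∈ Set.Ioo (0 : ℝ) (5/2)) (hc₁ : 0 < c₁) (hc₂ : 0 < c₂)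
    (g : ℝ → ℝ) (hg : ContDiff ℝ 2 g)
    (hode : ∀ z : ℝ, |z| ≤ Real.sqrt (2*α) →
      σ * deriv (deriv g) z + (5/2) * z * deriv g z + δh * g z = 0)
    (hb1 : g (Real.sqrt (2*α)) = 1) (hb2 : g (-Real.sqrt (2*α)) = 1)
    (v₃ : ℝ → ℝ → ℝ)
    (hv₃ : ∀ x y : ℝ, 0 < x →
      v₃ x y = x ^ δh * ((c₁/δh + c₂) * g (Real.sqrt x * y) - c₁/δh)) :
    ∀ x y : ℝ, 0 < x → x * y^2 ≤ 2*α →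
      (x^2 * deriv (fun x' => v₃ x' y) x
        + 2*x*y * deriv (fun y' => v₃ x y') y
        + σ * deriv (deriv (fun y' => v₃ x y')) y
        = -c₁ * x ^ (δh + 1)) ∧
      (x * y^2 = 2*α → v₃ x y = c₂ * x ^ δh) := by
  intro x y hx hxy
  have hδ : δh ≠ 0 := ne_of_gt hδh.1
  have hs : 0 < Real.sqrt x := Real.sqrt_pos.mpr hx
  have hss : Real.sqrt x ^ 2 = x := Real.sq_sqrt hx.le
  have hd1 : ∀ z, HasDerivAt g (deriv g z) z := fun z =>
    ((hg.differentiable (by norm_num)) z).hasDerivAt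
  have hg' : ContDiff ℝ 1 (deriv g) := by
    have h : ContDiff ℝ (1 + 1) g := by
      rw [one_add_one_eq_two]
      exact hg
    exact (contDiff_succ_iff_deriv.mp h).2.2
  have hd2 : ∀ z, HasDerivAt (deriv g) (deriv (deriv g) z) z := fun z =>
    ((hg'.differentiable (by norm_num)) z).hasDerivAt
  have hlin : ∀ t, HasDerivAt (fun y' : ℝ => Real.sqrt x * y') (Real.sqrt x) t := fun t => by
    simpa using (hasDerivAt_id t).const_mul (Real.sqrt x)
  have hy : deriv (fun y' => v₃ x y') = fun t =>
      x ^ δh * ((c₁/δh + c₂) * (deriv g (Real.sqrt x * t) * Real.sqrt x)) := by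
    have he : (fun y' => v₃ x y') =
        fun y' => x ^ δh * ((c₁/δh + c₂) * g (Real.sqrt x * y') - c₁/δh) :=
      funext fun y' => hv₃ x y' hx
    rw [he]
    funext t
    exact (((((hd1 (Real.sqrt x * t)).comp t (hlin t)).const_mul
      (c₁/δh + c₂)).sub_const (c₁/δh)).const_mul (x ^ δh)).deriv
  have hyy : deriv (deriv (fun y' => v₃ x y')) y =
      x ^ δh * ((c₁/δh + c₂) *
        (deriv (deriv g) (Real.sqrt x * y) * Real.sqrt x * Real.sqrt x)) := by
    rw [hy]
    exact (((((hd2 (Real.sqrt x * y)).comp y (hlin y)).mul_const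
      (Real.sqrt x)).const_mul (c₁/δh + c₂)).const_mul (x ^ δh)).deriv
  have hxd : deriv (fun x' => v₃ x' y) x =
      (δh * x ^ (δh - 1)) * ((c₁/δh + c₂) * g (Real.sqrt x * y) - c₁/δh) +
      x ^ δh * ((c₁/δh + c₂) *
        (deriv g (Real.sqrt x * y) * (1 / (2 * Real.sqrt x) * y))) := by
    have he : (fun x' => v₃ x' y) =ᶠ[nhds x]
        fun x' => x' ^ δh * ((c₁/δh + c₂) * g (Real.sqrt x' * y) - c₁/δh) := by
      filter_upwards [lt_mem_nhds hx] with x' hx' using hv₃ x' y hx'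
    rw [he.deriv_eq]
    have h1 : HasDerivAt (fun x' : ℝ => Real.sqrt x' * y) (1 / (2 * Real.sqrt x) * y) x :=
      (Real.hasDerivAt_sqrt hx.ne').mul_const y
    have h2 := (((HasDerivAt.comp x (hd1 (Real.sqrt x * y)) h1).const_mul
      (c₁/δh + c₂)).sub_const (c₁/δh))
    exact ((Real.hasDerivAt_rpow_const (p := δh) (Or.inl hx.ne')).mul h2).deriv
  have hsq : (Real.sqrt x * y) ^ 2 = x * y ^ 2 := by rw [mul_pow, hss]
  constructor
  · have ho := hode (Real.sqrt x * y) (Real.abs_le_sqrt (by rw [hsq]; exact hxy))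
    rw [hyy, hxd, hy, Real.rpow_sub_one hx.ne', Real.rpow_add_one hx.ne']
    beta_reduce
    generalize deriv (deriv g) (Real.sqrt x * y) = G2 at *
    generalize deriv g (Real.sqrt x * y) = G1 at *
    generalize g (Real.sqrt x * y) = G0 at *
    generalize x ^ δh = P at *
    have hK : δh * (c₁/δh) = c₁ := by field_simp
    generalize c₁/δh = k at *
    have e1 : x ^ 2 * (δh * (P / x)) = x * δh * P := by field_simp
    have e2 : x ^ 2 * (1 / (2 * Real.sqrt x)) = x * Real.sqrt x / 2 := by
      have : x / Real.sqrt x = Real.sqrt x := Real.div_sqrt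
      calc _ = x * (x / Real.sqrt x) / 2 := by field_simp
        _ = _ := by rw [this]
    linear_combination (k + c₂) * P * x * ho - P * x * hK +
      ((k + c₂) * G0 - k) * e1 + P * (k + c₂) * G1 * y * e2 + σ * P * (k + c₂) * G2 * hss
  · intro hb
    have hz : g (Real.sqrt x * y) = 1 := by
      have : (Real.sqrt x * y) ^ 2 = Real.sqrt (2 * α) ^ 2 := by
        rw [hsq, hb, Real.sq_sqrt (by positivity)]
      rcases sq_eq_sq_iff_eq_or_eq_neg.mp this with h | h
      · rw [h, hb1]
      · rw [h, hb2]
    rw [hv₃ x y hx, hz]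
    ring
end

section
/- Let σ > 0, α > 0 and δ̂ ∈ (0, 5/2). Then there exists a C² function g : [−√(2α), √(2α)] → ℝ such that σ·g''(z) + (5/2)·z·g'(z) + δ̂·g(z) = 0 for all z ∈ (−√(2α), √(2α)), g(√(2α)) = g(−√(2α)) = 1, and g(z) ≥ 1 for all z ∈ [−√(2α), √(2α)]. -/
namespace KummerAux

/-- the sum of a power series -/
noncomputable def E (a : ℕ → ℝ) (x : ℝ) : ℝ := ∑' n, a n * x ^ n

/-- coefficients of the derivative -/
noncomputable def D (a : ℕ → ℝ) (n : ℕ) : ℝ := (n + 1) * a (n + 1)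

/-- infinite radius of convergence -/
def S (a : ℕ → ℝ) : Prop := ∀ R : ℝ, 0 ≤ R → Summable fun n => |a n| * R ^ n

lemma S.summable {a : ℕ → ℝ} (h : S a) (x : ℝ) : Summable fun n => a n * x ^ n := by
  refine Summable.of_norm ?_
  simpa [abs_mul, abs_pow] using h |x| (abs_nonneg x)

lemma S.n {a : ℕ → ℝ} (h : S a) : S (fun n => n * a n) := by
  intro R hR
  refine Summable.of_nonneg_of_le (fun n => by positivity) (fun n => ?_) (h (2 * R) (by positivity))
  have h1 : (n : ℝ) ≤ 2 ^ n := by exact_mod_cast (Nat.lt_two_pow_self (n := n)).le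
  rw [abs_mul, mul_pow, Nat.abs_cast]
  have : 0 ≤ |a n| * R ^ n := by positivity
  nlinarith

lemma S.shift {a : ℕ → ℝ} (h : S a) : S (fun n => a (n + 1)) := by
  intro R hR
  have h1 := (summable_nat_add_iff 1).2 (h (R + 1) (by positivity))
  refine Summable.of_nonneg_of_le (fun n => by positivity) (fun n => ?_) h1
  have h2 : R ^ n ≤ (R + 1) ^ (n + 1) :=
    calc R ^ n ≤ (R + 1) ^ n := by gcongr; linarith
      _ ≤ (R + 1) ^ (n + 1) := pow_le_pow_right₀ (by linarith) (by omega)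
  gcongr

lemma S.d {a : ℕ → ℝ} (h : S a) : S (D a) := by
  have h1 := h.n.shift
  have h2 : D a = fun n : ℕ => ((n + 1 : ℕ) : ℝ) * a (n + 1) := by
    ext n; simp [D]
  rw [h2]; exact h1

lemma mul_E_D {a : ℕ → ℝ} (h : S a) (x : ℝ) : x * E (D a) x = E (fun n => n * a n) x := by
  have h1 := (h.n.summable x).tsum_eq_zero_add
  simp only [E]
  rw [h1, ← tsum_mul_left]
  simp only [D]
  simp
  congr 1; ext n; ring

lemma S.hasDerivAt {a : ℕ → ℝ} (h : S a) (x : ℝ) : HasDerivAt (E a) (E (D a) x) x := by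
  set R := |x| + 1 with hR
  have hR0 : 0 ≤ R := by positivity
  have key : HasDerivAt (fun y => ∑' n, a n * y ^ n) (∑' n, a n * (n * x ^ (n - 1))) x := by
    refine hasDerivAt_tsum_of_isPreconnected (u := fun n => |n * a n| * R ^ (n - 1))
      (t := Metric.ball 0 R) (y₀ := 0)
      ?_ Metric.isOpen_ball (convex_ball 0 R).isPreconnected
      (fun n y _ => (hasDerivAt_pow n y).const_mul (a n)) ?_ ?_ (h.summable 0) ?_
    · rw [← summable_nat_add_iff 1]
      simpa [D] using h.d R hR0
    · intro n y hy
      have : |y| ≤ R := by simpa using (Metric.mem_ball.1 hy).le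
      rw [Real.norm_eq_abs, abs_mul, abs_mul, abs_mul, abs_pow, ← mul_assoc, mul_comm |a n|]
      gcongr
    · simp; positivity
    · simp [hR]
  refine key.congr_deriv ?_
  have hs : Summable fun n => a n * (n * x ^ (n - 1)) := by
    rw [← summable_nat_add_iff 1]
    refine (h.d.summable x).congr fun n => ?_
    simp [D]; ring
  rw [hs.tsum_eq_zero_add]
  simp [E, D]
  congr 1; ext n; ring

/-- the coefficients of the Kummer series -/
noncomputable def B (c d : ℝ) : ℕ → ℝ
  | 0 => 1
  | n + 1 => (4 * c * n + 2 * c - d) / ((2 * n + 1) * (2 * n + 2)) * B c d n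

lemma B_nonneg {c d : ℝ} (hc : 0 < c) (hd : d < 2 * c) (n : ℕ) : 0 ≤ B c d n := by
  induction n with
  | zero => simp [B]
  | succ n ih =>
    have : 0 ≤ 4 * c * n + 2 * c - d := by
      have : 0 ≤ 4 * c * n := by positivity
      linarith
    rw [B]; positivity

lemma B_rec (c d : ℝ) (n : ℕ) :
    ((2 * n + 1) * (2 * n + 2)) * B c d (n + 1) = (4 * c * n + 2 * c - d) * B c d n := by
  rw [B]; field_simp

lemma D_le {c d : ℝ} (hc : 0 < c) (hd0 : 0 < d) (hd : d < 2 * c) (n : ℕ) :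
    D (B c d) n ≤ c * B c d n := by
  have h := B_rec c d n
  have h0 := B_nonneg hc hd n
  have hn : (0 : ℝ) < 2 * (2 * n + 1) := by positivity
  refine le_of_mul_le_mul_left ?_ hn
  simp only [D]
  nlinarith [mul_nonneg hd0.le h0]

lemma B_le {c d : ℝ} (hc : 0 < c) (hd0 : 0 < d) (hd : d < 2 * c) (n : ℕ) :
    B c d n ≤ c ^ n / n.factorial := by
  induction n with
  | zero => simp [B]
  | succ n ih =>
    have h := D_le hc hd0 hd n
    simp only [D] at h
    have h1 : c * B c d n ≤ c * (c ^ n / n.factorial) := by gcongr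
    have hn : (0 : ℝ) < n + 1 := by positivity
    refine le_of_mul_le_mul_left ((h.trans h1).trans_eq ?_) hn
    rw [Nat.factorial_succ]; push_cast
    field_simp
    ring

lemma B_S {c d : ℝ} (hc : 0 < c) (hd0 : 0 < d) (hd : d < 2 * c) : S (B c d) := by
  intro R hR
  refine Summable.of_nonneg_of_le (fun n => by positivity) (fun n => ?_)
    (Real.summable_pow_div_factorial (c * R))
  rw [abs_of_nonneg (B_nonneg hc hd n), mul_pow, mul_div_right_comm]
  have := B_le hc hd0 hd n
  gcongr

lemma E_ode {c d : ℝ} (hc : 0 < c) (hd0 : 0 < d) (hd : d < 2 * c) (x : ℝ) :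
    4 * x * E (D (D (B c d))) x + 2 * E (D (B c d)) x - 4 * c * x * E (D (B c d)) x
      - (2 * c - d) * E (B c d) x = 0 := by
  have hS := B_S hc hd0 hd
  have e1 := mul_E_D hS x
  have e2 := mul_E_D hS.d x
  have s1 := (hS.d.n.summable x).hasSum.mul_left 4
  have s2 := (hS.d.summable x).hasSum.mul_left 2
  have s3 := (hS.n.summable x).hasSum.mul_left (4 * c)
  have s4 := (hS.summable x).hasSum.mul_left (2 * c - d)
  have s := ((s1.add s2).sub s3).sub s4
  have h0 : (fun n : ℕ => 4 * (n * D (B c d) n * x ^ n) + 2 * (D (B c d) n * x ^ n)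
      - 4 * c * (n * B c d n * x ^ n) - (2 * c - d) * (B c d n * x ^ n)) = fun _ => 0 := by
    ext n
    have h := B_rec c d n
    simp only [D]
    linear_combination x ^ n * h
  rw [h0] at s
  have hz := s.unique hasSum_zero
  simp only [E] at e1 e2 ⊢
  linear_combination hz + 4 * e2 - 4 * c * e1

lemma E_contDiff {a : ℕ → ℝ} (h : S a) : ContDiff ℝ 2 (E a) := by
  have d0 : ∀ {b : ℕ → ℝ}, S b → deriv (E b) = E (D b) := fun hb => funext fun x => (hb.hasDerivAt x).deriv
  have hd : ∀ {b : ℕ → ℝ}, S b → Differentiable ℝ (E b) := fun hb x => (hb.hasDerivAt x).differentiableAt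
  have h1 : ContDiff ℝ 1 (E (D a)) := by
    rw [contDiff_one_iff_deriv, d0 h.d]
    exact ⟨hd h.d, (hd h.d.d).continuous⟩
  have h2 : ContDiff ℝ (1 + 1) (E a) := by
    rw [contDiff_succ_iff_deriv, d0 h]
    exact ⟨hd h, by simp, h1⟩
  simpa [one_add_one_eq_two] using h2

/-- the even positive solution -/
noncomputable def h (c d z : ℝ) : ℝ := Real.exp (-c * z ^ 2) * E (B c d) (z ^ 2)

lemma h_deriv {c d : ℝ} (hc : 0 < c) (hd0 : 0 < d) (hd : d < 2 * c) (z : ℝ) :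
    HasDerivAt (h c d) (Real.exp (-c * z ^ 2) *
      (2 * z * E (D (B c d)) (z ^ 2) - 2 * c * z * E (B c d) (z ^ 2))) z := by
  have hS := B_S hc hd0 hd
  have hp := hasDerivAt_pow 2 z
  have e := (hp.const_mul (-c)).exp
  have f := (hS.hasDerivAt (z ^ 2)).comp z hp
  refine (e.mul f).congr_deriv ?_
  simp
  ring

lemma h_deriv2 {c d : ℝ} (hc : 0 < c) (hd0 : 0 < d) (hd : d < 2 * c) (z : ℝ) :
    HasDerivAt (deriv (h c d)) (-2 * c * z * deriv (h c d) z - d * h c d z) z := by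
  have hS := B_S hc hd0 hd
  have h1 : deriv (h c d) = fun z => Real.exp (-c * z ^ 2) *
      (2 * z * E (D (B c d)) (z ^ 2) - 2 * c * z * E (B c d) (z ^ 2)) :=
    funext fun z => (h_deriv hc hd0 hd z).deriv
  rw [h1]
  have hp := hasDerivAt_pow 2 z
  have e := (hp.const_mul (-c)).exp
  have f := (hS.hasDerivAt (z ^ 2)).comp z hp
  have f1 := (hS.d.hasDerivAt (z ^ 2)).comp z hp
  have i := hasDerivAt_id z
  have ode := E_ode hc hd0 hd (z ^ 2)
  refine (e.mul (((i.const_mul 2).mul f1).sub ((i.const_mul (2 * c)).mul f))).congr_deriv ?_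
  simp [h]
  linear_combination Real.exp (-(c * z ^ 2)) * ode

lemma h_contDiff {c d : ℝ} (hc : 0 < c) (hd0 : 0 < d) (hd : d < 2 * c) :
    ContDiff ℝ 2 (h c d) := by
  have := E_contDiff (B_S hc hd0 hd)
  unfold h
  exact (Real.contDiff_exp.comp (by fun_prop)).mul (this.comp (by fun_prop))

lemma E_pos {c d : ℝ} (hc : 0 < c) (hd0 : 0 < d) (hd : d < 2 * c) {x : ℝ} (hx : 0 ≤ x) :
    0 < E (B c d) x := by
  have hS := B_S hc hd0 hd
  refine (hS.summable x).tsum_pos (fun n => mul_nonneg (B_nonneg hc hd n) (by positivity)) 0 ?_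
  simp [B]

lemma E_anti {c d : ℝ} (hc : 0 < c) (hd0 : 0 < d) (hd : d < 2 * c) :
    AntitoneOn (fun x => Real.exp (-c * x) * E (B c d) x) (Set.Ici 0) := by
  have hS := B_S hc hd0 hd
  have hder : ∀ x, HasDerivAt (fun x => Real.exp (-c * x) * E (B c d) x)
      (Real.exp (-c * x) * (E (D (B c d)) x - c * E (B c d) x)) x := by
    intro x
    refine ((((hasDerivAt_id x).const_mul (-c)).exp).mul (hS.hasDerivAt x)).congr_deriv ?_
    simp
    ring
  refine antitoneOn_of_deriv_nonpos (convex_Ici 0)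
    (fun x _ => (hder x).continuousAt.continuousWithinAt)
    (fun x _ => (hder x).differentiableAt.differentiableWithinAt) (fun x hx => ?_)
  rw [interior_Ici] at hx
  have hx0 : (0 : ℝ) < x := hx
  rw [(hder x).deriv]
  refine mul_nonpos_of_nonneg_of_nonpos (Real.exp_pos _).le (sub_nonpos.2 ?_)
  simp only [E]
  rw [← tsum_mul_left]
  refine (hS.d.summable x).tsum_le_tsum (fun n => ?_) ((hS.summable x).mul_left c)
  rw [← mul_assoc]
  have := D_le hc hd0 hd n
  gcongr

end KummerAux

open KummerAux in
/-- Existence of a `C²` solution `g` of the boundary value problem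
`σ g'' + (5/2) z g' + δ̂ g = 0` on `(−√(2α), √(2α))` with `g(±√(2α)) = 1`
and `g ≥ 1` on `[−√(2α), √(2α)]`. -/
theorem stmt_5 (σ α δh : ℝ) (hσ : 0 < σ) (hα : 0 < α)
    (hδh : δh ∈ Set.Ioo (0 : ℝ) (5/2)) :
    ∃ g : ℝ → ℝ, ContDiff ℝ 2 g ∧
      (∀ z ∈ Set.Ioo (-Real.sqrt (2*α)) (Real.sqrt (2*α)),
        σ * deriv (deriv g) z + (5/2) * z * deriv g z + δh * g z = 0) ∧
      g (Real.sqrt (2*α)) = 1 ∧ g (-Real.sqrt (2*α)) = 1 ∧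
      (∀ z ∈ Set.Icc (-Real.sqrt (2*α)) (Real.sqrt (2*α)), 1 ≤ g z) := by
  obtain ⟨hδ0, hδ1⟩ := hδh
  set L := Real.sqrt (2 * α) with hL
  set c := 5 / (4 * σ) with hcdef
  set d := δh / σ with hddef
  have hc : 0 < c := by positivity
  have hd0 : 0 < d := by positivity
  have hd : d < 2 * c := by
    have : 2 * c = (5 / 2) / σ := by rw [hcdef]; field_simp; norm_num
    rw [this]; exact div_lt_div_of_pos_right hδ1 hσ
  have hLpos : 0 < h c d L := mul_pos (Real.exp_pos _) (E_pos hc hd0 hd (sq_nonneg L))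
  have hdg : deriv (fun z => h c d z / h c d L) = fun z => deriv (h c d) z / h c d L :=
    funext fun z => deriv_div_const _
  refine ⟨fun z => h c d z / h c d L, (h_contDiff hc hd0 hd).div_const _, ?_, div_self hLpos.ne',
    ?_, ?_⟩
  · intro z _
    rw [hdg, deriv_div_const, (h_deriv2 hc hd0 hd z).deriv, hcdef, hddef]
    field_simp
    ring
  · have : h c d (-L) = h c d L := by simp [h]
    simp only [this]
    exact div_self hLpos.ne'
  · intro z hz
    rw [one_le_div hLpos]
    have hzL : z ^ 2 ≤ L ^ 2 := sq_le_sq' hz.1 hz.2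
    exact E_anti hc hd0 hd (Set.mem_Ici.2 (sq_nonneg z)) (Set.mem_Ici.2 (sq_nonneg L)) hzL
end

section
/- Let δ > 0 and define v(x,y) = |x|^(2δ)·x / |y|^(δ+1) for y ≠ 0. Then: (a) for every (x,y) with y ≠ 0, x²·∂ₓv(x,y) + 2xy·∂_yv(x,y) = −x^(2(δ+1)) / |y|^(δ+1); and (b) for every α > 0, every x ∈ ℝ and y ≠ 0, the function v₂(x,y,λ) = ((x²+λy²)/|y|)^δ · [ x/|y| + α√λ + √λ·(α²+1)^(−δ/2) ] converges to v(x,y) as λ → 0⁺. -/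
/-- The function `v(x,y) = |x|^(2δ) x / |y|^(δ+1)` solves the simplified
transport Poisson equation `(x²∂ₓ + 2xy∂_y) v = −x^(2(δ+1))/|y|^(δ+1)`, and is
the `λ → 0⁺` limit of the transport-region Lyapunov function `v₂(x,y,λ)`. -/
theorem stmt_6 (δ : ℝ) (hδ : 0 < δ) (v : ℝ → ℝ → ℝ)
    (hv : ∀ x y : ℝ, y ≠ 0 → v x y = |x| ^ (2*δ) * x / |y| ^ (δ+1)) :
    (∀ x y : ℝ, y ≠ 0 →
      x^2 * deriv (fun x' => v x' y) x + 2*x*y * deriv (fun y' => v x y') y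
        = -(((x^2 : ℝ) ^ (δ+1)) / |y| ^ (δ+1))) ∧
    (∀ α : ℝ, 0 < α → ∀ x y : ℝ, y ≠ 0 →
      Filter.Tendsto
        (fun lam : ℝ => ((x^2 + lam*y^2) / |y|) ^ δ *
          (x / |y| + α * Real.sqrt lam + Real.sqrt lam * (α^2 + 1) ^ (-(δ/2))))
        (nhdsWithin 0 (Set.Ioi 0)) (nhds (v x y))) := by
  have habs : ∀ (t p : ℝ), |t| ^ p = (t ^ 2) ^ (p / 2) := by
    intro t p
    rw [← sq_abs, ← Real.rpow_natCast, ← Real.rpow_mul (abs_nonneg t)]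
    congr 1
    push_cast
    ring
  have habs2 : ∀ (t : ℝ), |t| ^ (2 * δ) = (t ^ 2) ^ δ := by
    intro t
    rw [habs]
    congr 1
    ring
  refine ⟨?_, ?_⟩
  · intro x y hy
    by_cases hx : x = 0
    · subst hx
      have h1 : δ + 1 ≠ 0 := by positivity
      simp [Real.zero_rpow h1]
    have hx2 : (0 : ℝ) < x ^ 2 := by positivity
    have hy2 : (0 : ℝ) < y ^ 2 := by positivity
    have hd1 : HasDerivAt (fun x' => v x' y)
        (((2 * x) * δ * (x ^ 2) ^ (δ - 1) * x + (x ^ 2) ^ δ * 1) / |y| ^ (δ + 1)) x := by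
      have e : (fun x' => v x' y) = fun x' => (x' ^ 2) ^ δ * x' / |y| ^ (δ + 1) := by
        funext t
        rw [hv t y hy, habs2]
      rw [e]
      have h0 : HasDerivAt (fun t : ℝ => t ^ 2) (2 * x) x := by
        simpa using hasDerivAt_pow 2 x
      exact ((h0.rpow_const (Or.inl hx2.ne')).mul (hasDerivAt_id x)).div_const _
    have hd2 : HasDerivAt (fun y' => v x y')
        ((x ^ 2) ^ δ * x * ((2 * y) * (-((δ + 1) / 2)) * (y ^ 2) ^ (-((δ + 1) / 2) - 1))) y := by
      have h0 : HasDerivAt (fun t : ℝ => t ^ 2) (2 * y) y := by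
        simpa using hasDerivAt_pow 2 y
      refine ((h0.rpow_const (p := -((δ + 1) / 2))
        (Or.inl hy2.ne')).const_mul ((x ^ 2) ^ δ * x)).congr_of_eventuallyEq ?_
      filter_upwards [isOpen_ne.mem_nhds hy] with t ht
      rw [hv x t ht, habs2, habs t, Real.rpow_neg (sq_nonneg t), div_eq_mul_inv]
    rw [hd1.deriv, hd2.deriv, habs y, Real.rpow_sub_one hx2.ne', Real.rpow_sub_one hy2.ne',
      Real.rpow_neg hy2.le, Real.rpow_add_one hx2.ne']
    have hB : (y ^ 2) ^ ((δ + 1) / 2) ≠ 0 := (Real.rpow_pos_of_pos hy2 _).ne'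
    generalize (y ^ 2) ^ ((δ + 1) / 2) = B at *
    generalize (x ^ 2) ^ δ = A at *
    field_simp
    ring
  · intro α hα x y hy
    have hy' : 0 < |y| := abs_pos.mpr hy
    have hc : Continuous (fun lam : ℝ => ((x^2 + lam*y^2) / |y|) ^ δ *
          (x / |y| + α * Real.sqrt lam + Real.sqrt lam * (α^2 + 1) ^ (-(δ/2)))) := by
      refine Continuous.mul (Continuous.rpow_const (by fun_prop) (fun _ => Or.inr hδ.le)) ?_
      fun_prop
    have h := (hc.tendsto 0).mono_left (nhdsWithin_le_nhds (s := Set.Ioi 0))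
    convert h using 2
    rw [hv x y hy, habs2, Real.rpow_add_one hy'.ne']
    simp only [zero_mul, add_zero, Real.sqrt_zero, mul_zero]
    rw [Real.div_rpow (sq_nonneg x) hy'.le]
    rw [div_mul_div_comm]
end

section
/- Let m, b > 0 and γ > 1. Suppose φ : [0,∞) → (0,∞) is differentiable and satisfies φ'(t) ≤ −m·φ(t)^γ + b for all t ≥ 0. Then for every t > 0, φ(t) ≤ max{ (2b/m)^(1/γ), (m(γ−1)t/2)^(−1/(γ−1)) }. In particular the bound for t > 0 is independent of the initial value φ(0). -/
/-- A positive differentiable function on `[0,∞)` satisfying the super Lyapunov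
differential inequality `φ' ≤ −m φ^γ + b` (with `γ > 1`) obeys, for every `t > 0`,
the bound `φ(t) ≤ max{(2b/m)^(1/γ), (m(γ−1)t/2)^(−1/(γ−1))}`, independent of `φ(0)`. -/
theorem stmt_7 (m b γ : ℝ) (hm : 0 < m) (hb : 0 < b) (hγ : 1 < γ)
    (φ φ' : ℝ → ℝ)
    (hpos : ∀ t ∈ Set.Ici (0 : ℝ), 0 < φ t)
    (hderiv : ∀ t ∈ Set.Ici (0 : ℝ), HasDerivWithinAt φ (φ' t) (Set.Ici 0) t)
    (hineq : ∀ t ∈ Set.Ici (0 : ℝ), φ' t ≤ -m * (φ t) ^ γ + b) :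
    ∀ t : ℝ, 0 < t →
      φ t ≤ max ((2*b/m) ^ (1/γ)) ((m*(γ-1)*t/2) ^ (-(1/(γ-1)))) := by
  intro T hT
  rw [le_max_iff]
  by_contra! hcon
  obtain ⟨hA, hB⟩ := hcon
  set A := (2*b/m) ^ (1/γ) with hAdef
  have hg1 : 0 < γ - 1 := by linarith
  have hbm : 0 < 2*b/m := by positivity
  have hA0 : 0 < A := Real.rpow_pos_of_pos hbm _
  have hAγ : A ^ γ = 2*b/m := by
    rw [hAdef, ← Real.rpow_mul hbm.le, one_div_mul_cancel (by linarith), Real.rpow_one]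
  have hmA : m * A ^ γ = 2*b := by rw [hAγ]; field_simp
  have hcont : ContinuousOn φ (Set.Ici 0) := fun t ht => (hderiv t ht).continuousWithinAt
  have hbig : ∀ s, 0 ≤ s → s ≤ T → A < φ s := by
    intro s hs hsT
    by_contra! hle
    have := image_le_of_deriv_right_lt_deriv_boundary' (f := φ) (f' := φ') (a := s) (b := T)
      (B := fun _ => A) (B' := fun _ => 0)
      (hcont.mono (fun x hx => hs.trans hx.1))
      (fun x hx => (hderiv x (hs.trans hx.1)).mono
        (fun y hy => (hs.trans hx.1).trans hy))
      hle continuousOn_const (fun x _ => hasDerivWithinAt_const _ _ _)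
      (fun x hx hxe => by
        have h := hineq x (hs.trans hx.1)
        rw [hxe] at h
        linarith) (x := T) ⟨hsT, le_rfl⟩
    exact absurd this (not_le.mpr hA)
  have hψ : ∀ x, 0 ≤ x → HasDerivWithinAt (fun s => -(φ s) ^ (1 - γ))
      (-(φ' x * (1 - γ) * (φ x) ^ (1 - γ - 1))) (Set.Ici 0) x := fun x hx =>
    ((hderiv x hx).rpow_const (Or.inl (hpos x hx).ne')).neg
  have key := image_le_of_deriv_right_le_deriv_boundary (f := fun s => -(φ s) ^ (1 - γ))
      (f' := fun x => -(φ' x * (1 - γ) * (φ x) ^ (1 - γ - 1))) (a := 0) (b := T)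
      (B := fun s => -(m*(γ-1)/2) * s) (B' := fun _ => -(m*(γ-1)/2))
      (fun x hx => ((hψ x hx.1).continuousWithinAt).mono (fun y hy => hy.1))
      (fun x hx => (hψ x hx.1).mono (fun y hy => hx.1.trans hy))
      (by
        have := Real.rpow_pos_of_pos (hpos 0 Set.self_mem_Ici) (1 - γ)
        simp only [mul_zero]; linarith)
      (by fun_prop)
      (fun x _ => by simpa using ((hasDerivAt_id x).const_mul (-(m*(γ-1)/2))).hasDerivWithinAt)
      (fun x hx => by
        have hp := hpos x hx.1
        have h := hineq x hx.1
        have h2 : A ^ γ ≤ φ x ^ γ :=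
          Real.rpow_le_rpow hA0.le (hbig x hx.1 hx.2.le).le (by linarith)
        have h3 : φ' x ≤ -(m/2) * φ x ^ γ := by nlinarith
        have h4 : φ x ^ (1 - γ - 1) * φ x ^ γ = 1 := by
          rw [← Real.rpow_add hp]; simp
        have h5 : 0 < φ x ^ (1 - γ - 1) := Real.rpow_pos_of_pos hp _
        have h6 : φ' x * φ x ^ (1 - γ - 1) ≤ -(m/2) := by
          calc _ ≤ -(m/2) * φ x ^ γ * φ x ^ (1 - γ - 1) := by gcongr
            _ = -(m/2) * (φ x ^ (1 - γ - 1) * φ x ^ γ) := by ring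
            _ = _ := by rw [h4, mul_one]
        nlinarith) (x := T) ⟨hT.le, le_rfl⟩
  have hpT := hpos T hT.le
  have hc : 0 < m*(γ-1)*T/2 := by positivity
  have hk : m*(γ-1)*T/2 ≤ φ T ^ (1 - γ) := by
    linarith
  have h7 := Real.rpow_le_rpow_of_nonpos hc hk (z := -(1/(γ-1)))
    (by have : 0 < 1/(γ-1) := by positivity
        linarith)
  rw [← Real.rpow_mul hpT.le, show (1 - γ) * -(1/(γ-1)) = 1 by field_simp; ring,
    Real.rpow_one] at h7
  linarith
end

section
/- Let (x₀, y₀) ∈ ℝ² with (x₀, y₀) ≠ (0,0) and not (y₀ = 0 and x₀ > 0). Define D(t) = (1 − x₀t)² + (y₀t)², x(t) = (x₀ − (x₀²+y₀²)t)/D(t) and y(t) = y₀/D(t). Then D(t) > 0 for all t ≥ 0, and (x(t), y(t)) → (0, 0) as t → ∞. Hence the ω-limit set of every initial condition not on the positive x-axis is the origin. -/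
/-- For any initial condition `(x₀,y₀)` that is neither the origin nor on the
positive x-axis, the explicit solution of `ẋ = x² − y²`, `ẏ = 2xy` is defined
for all `t ≥ 0` (`D(t) > 0`) and converges to the origin as `t → ∞`. -/
theorem stmt_12 (x₀ y₀ : ℝ) (hne : (x₀, y₀) ≠ (0, 0))
    (hnotpos : ¬(y₀ = 0 ∧ 0 < x₀))
    (D x y : ℝ → ℝ)
    (hD : ∀ t, D t = (1 - x₀*t)^2 + (y₀*t)^2)
    (hx : ∀ t, x t = (x₀ - (x₀^2 + y₀^2)*t) / D t)
    (hy : ∀ t, y t = y₀ / D t) :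
    (∀ t : ℝ, 0 ≤ t → 0 < D t) ∧
    Filter.Tendsto x Filter.atTop (nhds 0) ∧
    Filter.Tendsto y Filter.atTop (nhds 0) := by
  have hr : 0 < x₀^2 + y₀^2 := by
    by_contra h
    have h1 : x₀ = 0 := by nlinarith [sq_nonneg x₀, sq_nonneg y₀]
    have h2 : y₀ = 0 := by nlinarith [sq_nonneg x₀, sq_nonneg y₀]
    exact hne (by rw [h1, h2])
  have hpos : ∀ t : ℝ, 0 ≤ t → 0 < D t := by
    intro t ht
    rw [hD]
    by_cases hy0 : y₀ = 0
    · have hx0 : x₀ ≤ 0 := by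
        by_contra h
        exact hnotpos ⟨hy0, not_le.mp h⟩
      have : 0 < 1 - x₀ * t := by nlinarith [mul_nonneg (neg_nonneg.mpr hx0) ht]
      positivity
    · by_cases ht0 : t = 0
      · simp [ht0]
      · have : 0 < (y₀ * t)^2 := by positivity
        nlinarith [sq_nonneg (1 - x₀ * t)]
  have hDtop : Filter.Tendsto D Filter.atTop Filter.atTop := by
    have h1 : Filter.Tendsto (fun t : ℝ => (x₀^2 + y₀^2) * t + (-2 * x₀))
        Filter.atTop Filter.atTop :=
      Filter.tendsto_atTop_add_const_right _ _ (Filter.tendsto_id.const_mul_atTop hr)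
    have h2 := Filter.tendsto_atTop_add_const_right _ (1 : ℝ) (Filter.tendsto_id.atTop_mul_atTop₀ h1)
    refine h2.congr fun t => ?_
    rw [hD]
    simp only [id]
    ring
  have hlim : Filter.Tendsto (fun t => √((x₀^2 + y₀^2) / D t)) Filter.atTop (nhds 0) := by
    have := (hDtop.const_div_atTop (x₀^2 + y₀^2)).sqrt
    simpa using this
  have key : ∀ t, (x₀ - (x₀^2 + y₀^2)*t)^2 + y₀^2 = (x₀^2 + y₀^2) * D t := by
    intro t
    rw [hD]
    ring
  have heq : ∀ t : ℝ, 0 ≤ t → (x t)^2 + (y t)^2 = (x₀^2 + y₀^2) / D t := by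
    intro t ht
    have hd := (hpos t ht).ne'
    rw [hx, hy, div_pow, div_pow, ← add_div, key]
    field_simp
  refine ⟨hpos, ?_, ?_⟩
  · refine squeeze_zero_norm' ?_ hlim
    filter_upwards [Filter.eventually_ge_atTop 0] with t ht
    exact Real.abs_le_sqrt (by nlinarith [heq t ht, sq_nonneg (y t)])
  · refine squeeze_zero_norm' ?_ hlim
    filter_upwards [Filter.eventually_ge_atTop 0] with t ht
    exact Real.abs_le_sqrt (by nlinarith [heq t ht, sq_nonneg (x t)])
end

section
/- Let R > 0 and let (x₀, y₀) ∈ ℝ² with not (y₀ = 0 and x₀ > 0). Define D(t) = (1 − x₀t)² + (y₀t)², x(t) = (x₀ − (x₀²+y₀²)t)/D(t) and y(t) = y₀/D(t). Then there exists t ∈ [0, 2/R] such that D(t) > 0 and x(t)² + y(t)² ≤ R². That is, the time for the deterministic trajectory to enter the closed ball of radius R about the origin is uniformly bounded by 2/R over all initial conditions not on the positive x-axis. -/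
/-- Uniform return time to a ball: for any `R > 0` and any initial condition
`(x₀,y₀)` not on the positive x-axis, the explicit deterministic trajectory
enters the closed ball of radius `R` about the origin at some time
`t ∈ [0, 2/R]` at which it is defined. -/
theorem stmt_13 (R : ℝ) (hR : 0 < R) (x₀ y₀ : ℝ)
    (hnotpos : ¬(y₀ = 0 ∧ 0 < x₀))
    (D x y : ℝ → ℝ)
    (hD : ∀ t, D t = (1 - x₀*t)^2 + (y₀*t)^2)
    (hx : ∀ t, x t = (x₀ - (x₀^2 + y₀^2)*t) / D t)
    (hy : ∀ t, y t = y₀ / D t) :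
    ∃ t ∈ Set.Icc (0 : ℝ) (2/R), 0 < D t ∧ (x t)^2 + (y t)^2 ≤ R^2 := by
  have key : ∀ t, 0 < D t → x₀^2 + y₀^2 ≤ R^2 * D t → (x t)^2 + (y t)^2 ≤ R^2 := by
    intro t hpos hle
    have e : (x t)^2 + (y t)^2 = (x₀^2 + y₀^2) / D t := by
      rw [hx, hy]
      have hne := hpos.ne'
      field_simp
      rw [hD]
      ring
    rw [e, div_le_iff₀ hpos]
    exact hle
  obtain ⟨r, hr0, hr⟩ : ∃ r : ℝ, 0 ≤ r ∧ r^2 = x₀^2 + y₀^2 :=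
    ⟨Real.sqrt (x₀^2 + y₀^2), Real.sqrt_nonneg _, Real.sq_sqrt (by positivity)⟩
  have hxr : x₀ ≤ r := by
    exact le_trans (le_abs_self _) (abs_le_of_sq_le_sq (by nlinarith [sq_nonneg y₀]) hr0)
  by_cases h : r ≤ R
  · have h0 : D 0 = 1 := by rw [hD]; ring
    refine ⟨0, ⟨le_refl _, by positivity⟩, by rw [h0]; norm_num, key 0 (by rw [h0]; norm_num) ?_⟩
    rw [h0]
    nlinarith
  · push Not at h
    have e : R^2 * D (2/R) = R^2 - 4 * x₀ * R + 4 * r^2 := by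
      rw [hD, hr]
      field_simp
      ring
    have hle : r^2 ≤ R^2 * D (2/R) := by
      rw [e]
      nlinarith [mul_nonneg hR.le (sub_nonneg.2 hxr), mul_pos (sub_pos.2 h) (sub_pos.2 h), mul_pos (sub_pos.2 h) hR]
    have hpos : 0 < D (2/R) := by
      have h1 : 0 < R^2 * D (2/R) := lt_of_lt_of_le (by have := hR.trans h; positivity) hle
      exact pos_of_mul_pos_right h1 (by positivity)
    exact ⟨2/R, ⟨by positivity, le_refl _⟩, hpos, key _ hpos (hr ▸ hle)⟩
end

section
/- Let T > 0, let y : [0, T] → ℝ be continuous, and let x : [0, T] → ℝ be differentiable with x'(t) = x(t)² − y(t)² for all t ∈ [0, T]. If x(0) < 0 then x(t) < 0 for all t ∈ [0, T]. -/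
/-- Invariance of the open left half-plane: if `x' = x² − y²` on `[0,T]` (for any
continuous `y`) and `x(0) < 0`, then `x(t) < 0` for all `t ∈ [0,T]`. -/
theorem stmt_14 (T : ℝ) (hT : 0 < T) (x y : ℝ → ℝ)
    (hy : ContinuousOn y (Set.Icc 0 T))
    (hx : ∀ t ∈ Set.Icc (0 : ℝ) T,
      HasDerivWithinAt x ((x t)^2 - (y t)^2) (Set.Icc 0 T) t)
    (h0 : x 0 < 0) :
    ∀ t ∈ Set.Icc (0 : ℝ) T, x t < 0 := by
  intro t ht
  have hB : ∀ s : ℝ, HasDerivAt (fun s => x 0 * Real.exp ((x 0 - 1) * s))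
      (x 0 * (Real.exp ((x 0 - 1) * s) * (x 0 - 1))) s := by
    intro s
    have h1 : HasDerivAt (fun s : ℝ => (x 0 - 1) * s) (x 0 - 1) s := by
      simpa using (hasDerivAt_id s).const_mul (x 0 - 1)
    exact (h1.exp).const_mul (x 0)
  have key := image_le_of_deriv_right_lt_deriv_boundary (f := x)
    (f' := fun t => (x t)^2 - (y t)^2) (a := 0) (b := T)
    (fun s hs => (hx s hs).continuousWithinAt)
    (fun s hs => (hx s ⟨hs.1, hs.2.le⟩).mono_of_mem_nhdsWithin
      (Icc_mem_nhdsGE_of_mem hs))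
    (by simp) hB
    (by
      intro s hs h
      have he := Real.exp_pos ((x 0 - 1) * s)
      have he1 : Real.exp ((x 0 - 1) * s) ≤ 1 := by
        rw [Real.exp_le_one_iff]
        nlinarith [hs.1]
      simp only [h]
      generalize Real.exp ((x 0 - 1) * s) = e at he he1
      have h2 : 0 < e * (-x 0) := mul_pos he (by linarith)
      have h3 : 0 ≤ x 0 ^ 2 * (e * (1 - e)) :=
        mul_nonneg (sq_nonneg _) (mul_nonneg he.le (by linarith))
      nlinarith [sq_nonneg (y s)])
  have := key ht
  have he := Real.exp_pos ((x 0 - 1) * t)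
  have h2 : x 0 * Real.exp ((x 0 - 1) * t) < 0 := mul_neg_of_neg_of_pos h0 he
  linarith
end
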